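/- arXiv:2605.00301 — 4 statements merged into one kernel-verified Lean document; each statement's English description precedes it below -/
import Mathlib

section
/- For every real $u > 0$, one has $u \sum_{p \geq 3\ \mathrm{prime}} \frac{\log p}{(p-2)\, p^u} \leq 1$. -/
open scoped LSeries.notation ArithmeticFunction.vonMangoldt ArithmeticFunction.zeta

lemma tsum_vonMangoldt_mul_tsum {s : ℝ} (hs : 1 < s) :
    (∑' n : ℕ, Λ n / (n : ℝ) ^ s) * (∑' n : ℕ, 1 / (n : ℝ) ^ s) =
      ∑' n : ℕ, Real.log n / (n : ℝ) ^ s := by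
  have hs' : 1 < (s : ℂ).re := by simpa using hs
  have key := LSeries_convolution' (ArithmeticFunction.LSeriesSummable_vonMangoldt hs')
    (ArithmeticFunction.LSeriesSummable_zeta_iff.mpr hs')
  rw [ArithmeticFunction.convolution_vonMangoldt_zeta] at key
  have cast (f : ℕ → ℝ) (g : ℕ → ℂ) (h0 : f 0 = 0) (hfg : ∀ n, n ≠ 0 → g n = f n) :
      L g s = ((∑' n : ℕ, f n / (n : ℝ) ^ s : ℝ) : ℂ) := by
    rw [LSeries, Complex.ofReal_tsum]
    refine tsum_congr fun n => ?_
    rcases eq_or_ne n 0 with rfl | hn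
    · simp [h0]
    · rw [LSeries.term_of_ne_zero hn, hfg n hn]
      push_cast
      rw [Complex.ofReal_cpow n.cast_nonneg]
      simp
  rw [cast (fun n => Real.log n) _ (by simp) (fun n _ => by simp [Complex.natCast_log]),
    cast (fun n => Λ n) _ (by simp) (fun n _ => by simp),
    cast (fun n => if n = 0 then 0 else 1) _ (by simp) (fun n hn => by simp [hn])] at key
  have h1 : ∀ n : ℕ, (if n = 0 then (0 : ℝ) else 1) / (n : ℝ) ^ s = 1 / (n : ℝ) ^ s := by
    intro n
    rcases eq_or_ne n 0 with rfl | hn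
    · simp [Real.zero_rpow (by linarith : s ≠ 0)]
    · simp [hn]
  simp only [h1] at key
  exact_mod_cast key.symm

lemma summable_vonMangoldt_div_rpow {s : ℝ} (hs : 1 < s) :
    Summable fun n : ℕ => Λ n / (n : ℝ) ^ s := by
  have hs' : 1 < (s : ℂ).re := by simpa using hs
  have h := (ArithmeticFunction.LSeriesSummable_vonMangoldt hs').norm
  refine h.congr fun n => ?_
  rcases eq_or_ne n 0 with rfl | hn
  · simp
  · rw [LSeries.norm_term_eq]
    simp [hn, abs_of_nonneg ArithmeticFunction.vonMangoldt_nonneg]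

lemma hasSum_prime_log_div_rpow_sub_one {s : ℝ} (hs : 1 < s) :
    HasSum (fun n : ℕ => if n.Prime then Real.log n / ((n : ℝ) ^ s - 1) else 0)
      (∑' n : ℕ, Λ n / (n : ℝ) ^ s) := by
  have hsupp : Function.support (fun n : ℕ => Λ n / (n : ℝ) ^ s) ⊆ {n | IsPrimePow n} := by
    intro n hn
    by_contra h
    exact hn (by simp [ArithmeticFunction.vonMangoldt_eq_zero_iff.mpr h])
  have h1 := (hasSum_subtype_iff_of_support_subset hsupp).mpr
    (summable_vonMangoldt_div_rpow hs).hasSum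
  have h2 := (Nat.Primes.prodNatEquiv.hasSum_iff.mpr h1).prod_fiberwise
    (g := fun p : Nat.Primes => Real.log p / ((p : ℝ) ^ s - 1)) ?_
  · have h3 := (hasSum_subtype_iff_indicator (s := {n : ℕ | n.Prime})
      (f := fun n : ℕ => Real.log n / ((n : ℝ) ^ s - 1))).mp h2
    convert h3 using 2 with n
    simp [Set.indicator_apply]
  · intro p
    have hp1 : (1 : ℝ) < p := by exact_mod_cast p.2.one_lt
    have hps : 1 < (p : ℝ) ^ s := Real.one_lt_rpow hp1 (by linarith)
    have hgeo := (hasSum_geometric_of_lt_one (r := ((p : ℝ) ^ s)⁻¹) (by positivity)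
      (inv_lt_one_of_one_lt₀ hps)).mul_left (Real.log p * ((p : ℝ) ^ s)⁻¹)
    have hval : Real.log p / ((p : ℝ) ^ s - 1) =
        Real.log p * ((p : ℝ) ^ s)⁻¹ * (1 - ((p : ℝ) ^ s)⁻¹)⁻¹ := by
      have : (p : ℝ) ^ s - 1 ≠ 0 := by linarith
      field_simp
    rw [hval]
    refine hgeo.congr_fun fun k => ?_
    have hpow : ((p : ℝ) ^ (k + 1)) ^ s = ((p : ℝ) ^ s) ^ (k + 1) := by
      rw [← Real.rpow_natCast, ← Real.rpow_mul (by positivity), mul_comm,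
        Real.rpow_mul (by positivity), Real.rpow_natCast]
    simp [ArithmeticFunction.vonMangoldt_apply_pow,
      ArithmeticFunction.vonMangoldt_apply_prime p.2, hpow]
    field_simp
    ring

lemma rpow_neg_sub_rpow_neg_le_trapezoid {u x y : ℝ} (hu : 0 < u) (hx : 0 < x) (hxy : x ≤ y) :
    (x ^ (-u) - y ^ (-u)) / u ≤ (y - x) * (x ^ (-(1 + u)) + y ^ (-(1 + u))) / 2 := by
  let φ : ℝ → ℝ := fun t =>
    (t - x) * (x ^ (-(1 + u)) + t ^ (-(1 + u))) / 2 - (x ^ (-u) - t ^ (-u)) / u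
  have hd : ∀ t, 0 < t → HasDerivAt φ
      ((1 * (x ^ (-(1 + u)) + t ^ (-(1 + u))) + (t - x) * (-(1 + u) * t ^ (-(1 + u) - 1))) / 2
        - (-(-u * t ^ (-u - 1))) / u) t := by
    intro t ht
    have h1 := Real.hasDerivAt_rpow_const (x := t) (p := -(1 + u)) (Or.inl ht.ne')
    have h2 := Real.hasDerivAt_rpow_const (x := t) (p := -u) (Or.inl ht.ne')
    exact ((((hasDerivAt_id t).sub_const x).mul (h1.const_add _)).div_const 2).sub
      ((h2.const_sub _).div_const u)
  have hmono : MonotoneOn φ (Set.Ici x) := by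
    refine monotoneOn_of_deriv_nonneg (convex_Ici x)
      (fun t ht => (hd t (hx.trans_le ht)).continuousAt.continuousWithinAt)
      (fun t ht => (hd t ?_).differentiableAt.differentiableWithinAt) fun t ht => ?_
    · rw [interior_Ici] at ht
      exact hx.trans ht
    · rw [interior_Ici] at ht
      have ht0 : 0 < t := hx.trans ht
      rw [(hd t ht0).deriv]
      have e1 : t ^ (-u - 1) = t ^ (-(1 + u)) := by ring_nf
      have e2 : t ^ (-(1 + u) - 1) = t ^ (-(1 + u)) / t := Real.rpow_sub_one ht0.ne' _
      have e3 : x ^ (-(1 + u)) = t ^ (-(1 + u)) * (x / t) ^ (-(1 + u)) := by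
        rw [← Real.mul_rpow ht0.le (by positivity)]
        congr 1
        field_simp
      have bern : 1 + -(1 + u) * (x / t - 1) ≤ (x / t) ^ (-(1 + u)) := by
        have h1 := one_add_mul_self_le_rpow_one_add (s := t / x - 1) (p := 1 + u)
          (by linarith [div_pos ht0 hx]) (by linarith)
        rw [add_sub_cancel] at h1
        rw [Real.rpow_neg (by positivity), ← Real.inv_rpow (by positivity), inv_div]
        have h2 : t / x - 1 - (1 - x / t) = (t - x) ^ 2 / (t * x) := by
          field_simp
        have h3 : 0 ≤ (1 + u) * ((t - x) ^ 2 / (t * x)) := by positivity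
        rw [← h2] at h3
        linarith
      have hT : 0 < t ^ (-(1 + u)) := by positivity
      rw [e1, e2, e3]
      generalize t ^ (-(1 + u)) = T at *
      generalize (x / t) ^ (-(1 + u)) = Q at *
      have : (1 * (T * Q + T) + (t - x) * (-(1 + u) * (T / t))) / 2 - -(-u * T) / u
          = T * (Q - (1 + -(1 + u) * (x / t - 1))) / 2 := by
        field_simp
        ring
      rw [this]
      have := sub_nonneg.mpr bern
      positivity
  have := hmono (Set.mem_Ici.mpr le_rfl) (Set.mem_Ici.mpr hxy) hxy
  simp only [φ, sub_self, zero_mul, zero_div] at this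
  linarith

lemma one_div_add_half_le_tsum {u : ℝ} (hu : 0 < u) :
    1 / u + 1 / 2 ≤ ∑' n : ℕ, 1 / (n : ℝ) ^ (1 + u) := by
  have hs : Summable fun n : ℕ => 1 / (n : ℝ) ^ (1 + u) :=
    Real.summable_one_div_nat_rpow.mpr (by linarith)
  have hlim : Filter.Tendsto (fun N : ℕ => (1 - ((N : ℝ) + 1) ^ (-u)) / u + 1 / 2)
      Filter.atTop (nhds ((1 - 0) / u + 1 / 2)) := by
    refine ((tendsto_const_nhds.sub ?_).div_const u).add_const _
    exact (tendsto_rpow_neg_atTop hu).comp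
      (Filter.tendsto_atTop_add_const_right _ 1 tendsto_natCast_atTop_atTop)
  rw [sub_zero] at hlim
  refine le_of_tendsto hlim (Filter.Eventually.of_forall fun N => ?_)
  have key : (1 - ((N : ℝ) + 1) ^ (-u)) / u + 1 / 2 + 1 / 2 * (1 / ((N : ℝ) + 1) ^ (1 + u)) ≤
      ∑ n ∈ Finset.range (N + 2), 1 / (n : ℝ) ^ (1 + u) := by
    induction N with
    | zero =>
      simp [Finset.sum_range_succ, Real.zero_rpow (by linarith : 1 + u ≠ 0)]
      norm_num
    | succ N ih =>
      rw [Finset.sum_range_succ]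
      have := rpow_neg_sub_rpow_neg_le_trapezoid hu (x := N + 1) (y := N + 1 + 1)
        (by positivity) (by linarith)
      rw [Real.rpow_neg (x := (N : ℝ) + 1) (y := 1 + u) (by positivity),
        Real.rpow_neg (x := (N : ℝ) + 1 + 1) (y := 1 + u) (by positivity)] at this
      push_cast
      rw [show (N : ℝ) + 2 = N + 1 + 1 by ring]
      simp only [one_div, sub_div] at *
      linarith
  have := hs.sum_le_tsum (Finset.range (N + 2)) (fun n _ => by positivity)
  have : 0 ≤ 1 / 2 * (1 / ((N : ℝ) + 1) ^ (1 + u)) := by positivity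
  linarith

lemma log_div_rpow_le_sub {u x : ℝ} (hu : 0 < u) (hx : 3 ≤ x) :
    Real.log (x + 1) / (x + 1) ^ (1 + u) ≤
      x ^ (-u) * (Real.log x / u + 1 / u ^ 2) -
        (x + 1) ^ (-u) * (Real.log (x + 1) / u + 1 / u ^ 2) := by
  have hd : ∀ t : ℝ, 0 < t →
      HasDerivAt (fun t : ℝ => t ^ (-u) * (Real.log t / u + 1 / u ^ 2))
        (-(Real.log t / t ^ (1 + u))) t := by
    intro t ht
    have h2 := Real.hasDerivAt_rpow_const (x := t) (p := -u) (Or.inl ht.ne')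
    have h3 := ((Real.hasDerivAt_log ht.ne').div_const u).add_const (1 / u ^ 2)
    refine (h2.mul h3).congr_deriv ?_
    have e1 : t ^ (-u - 1) = t ^ (-u) / t := Real.rpow_sub_one ht.ne' _
    have e2 : t ^ (1 + u) = t / t ^ (-u) := by
      rw [Real.rpow_neg ht.le, Real.rpow_add ht, Real.rpow_one]
      field_simp
    rw [e1, e2]
    have : 0 < t ^ (-u) := by positivity
    field_simp
    ring
  obtain ⟨c, hc, hce⟩ := exists_hasDerivAt_eq_slope _ _ (show x < x + 1 by linarith)
    (fun t ht => (hd t (by linarith [ht.1])).continuousAt.continuousWithinAt)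
    (fun t ht => hd t (by linarith [ht.1]))
  have hanti := Real.log_div_self_rpow_antitoneOn (a := 1 + u) (by linarith)
  have hexp : ∀ y : ℝ, 3 ≤ y → y ∈ Set.Ici (Real.exp (1 + u)⁻¹) := by
    intro y hy
    have : Real.exp (1 + u)⁻¹ ≤ Real.exp 1 :=
      Real.exp_le_exp.mpr (inv_le_one_of_one_le₀ (by linarith))
    have := Real.exp_one_lt_d9
    simp only [Set.mem_Ici]
    linarith
  have := hanti (hexp c (by linarith [hc.1])) (hexp (x + 1) (by linarith)) hc.2.le
  simp only at this
  rw [show x + 1 - x = 1 by ring, div_one] at hce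
  linarith

lemma tsum_log_div_rpow_le {u : ℝ} (hu : 0 < u) :
    ∑' n : ℕ, Real.log n / (n : ℝ) ^ (1 + u) ≤
      Real.log 2 / 2 ^ (1 + u) + Real.log 3 / 3 ^ (1 + u) +
        3 ^ (-u) * (Real.log 3 / u + 1 / u ^ 2) := by
  have hnn : ∀ n : ℕ, 0 ≤ Real.log n / (n : ℝ) ^ (1 + u) := fun n =>
    div_nonneg (Real.log_natCast_nonneg n) (by positivity)
  refine Real.tsum_le_of_sum_range_le hnn fun N => ?_
  have key : ∀ N : ℕ, ∑ n ∈ Finset.range (N + 4), Real.log n / (n : ℝ) ^ (1 + u) ≤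
      Real.log 2 / 2 ^ (1 + u) + Real.log 3 / 3 ^ (1 + u) +
        3 ^ (-u) * (Real.log 3 / u + 1 / u ^ 2) -
        ((N : ℝ) + 3) ^ (-u) * (Real.log ((N : ℝ) + 3) / u + 1 / u ^ 2) := by
    intro N
    induction N with
    | zero => simp [Finset.sum_range_succ]
    | succ N ih =>
      rw [show N + 1 + 4 = N + 4 + 1 by ring, Finset.sum_range_succ]
      have := log_div_rpow_le_sub hu (x := N + 3) (by linarith [N.cast_nonneg (α := ℝ)])
      push_cast
      rw [show (N : ℝ) + 4 = N + 3 + 1 by ring, show (N : ℝ) + 1 + 3 = N + 3 + 1 by ring]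
      linarith
  have h1 : ∑ n ∈ Finset.range N, Real.log n / (n : ℝ) ^ (1 + u) ≤
      ∑ n ∈ Finset.range (N + 4), Real.log n / (n : ℝ) ^ (1 + u) :=
    Finset.sum_le_sum_of_subset_of_nonneg (Finset.range_mono (by omega)) fun n _ _ => hnn n
  have h2 : 0 ≤ ((N : ℝ) + 3) ^ (-u) * (Real.log ((N : ℝ) + 3) / u + 1 / u ^ 2) := by
    have := Real.log_nonneg (x := (N : ℝ) + 3) (by linarith [N.cast_nonneg (α := ℝ)])
    positivity
  linarith [key N]

lemma log_le_of_pow_le {p k m : ℕ} {b : ℝ} (hk : k ≠ 0) (h : p ^ k ≤ 2 ^ m)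
    (hb : m * 0.6931471808 ≤ k * b) : Real.log p ≤ b := by
  rcases Nat.eq_zero_or_pos p with rfl | hp
  · have : (0 : ℝ) ≤ k * b := le_trans (by positivity) hb
    have hk' : (0 : ℝ) < k := by positivity
    simpa using nonneg_of_mul_nonneg_right this hk'
  have hlog : k * Real.log p ≤ m * Real.log 2 := by
    rw [← Real.log_pow, ← Real.log_pow]
    exact Real.log_le_log (by positivity) (by exact_mod_cast h)
  have := mul_le_mul_of_nonneg_left Real.log_two_lt_d9.le (m.cast_nonneg (α := ℝ))
  exact le_of_mul_le_mul_left (hlog.trans (this.trans hb)) (by positivity)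

/-- The weight `log p / ((p - 1) (p - 2))` on primes `p ≥ 5`. -/
noncomputable def primeWeight (n : ℕ) : ℝ :=
  if n.Prime ∧ 5 ≤ n then Real.log n / (((n : ℝ) - 1) * ((n : ℝ) - 2)) else 0

lemma primeWeight_nonneg (n : ℕ) : 0 ≤ primeWeight n := by
  unfold primeWeight
  split_ifs with h
  · have : (5 : ℝ) ≤ n := by exact_mod_cast h.2
    exact div_nonneg (Real.log_natCast_nonneg n) (mul_nonneg (by linarith) (by linarith))
  · exact le_rfl

lemma log_div_le_telescope {x : ℝ} (hx : 3 < x) :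
    Real.log x / ((x - 1) * (x - 2)) ≤
      (Real.log x + 1) / (2 * (x - 3)) - (Real.log (x + 2) + 1) / (2 * (x - 1)) := by
  have hlog : Real.log (x + 2) ≤ Real.log x + 2 / x := by
    have h1 := Real.log_le_sub_one_of_pos (x := (x + 2) / x) (by positivity)
    rw [Real.log_div (by positivity) (by positivity), add_div, div_self (by positivity)] at h1
    linarith
  have hlx : 0 ≤ Real.log x := Real.log_nonneg (by linarith)
  have h1 : 0 < x - 1 := by linarith
  have h2 : 0 < x - 2 := by linarith
  have h3 : 0 < x - 3 := by linarith
  calc Real.log x / ((x - 1) * (x - 2)) ≤ Real.log x / ((x - 1) * (x - 3)) := by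
        gcongr
        linarith
    _ ≤ (Real.log x + 1) / (2 * (x - 3)) - (Real.log x + 2 / x + 1) / (2 * (x - 1)) := by
        rw [← sub_nonneg]
        have : (Real.log x + 1) / (2 * (x - 3)) - (Real.log x + 2 / x + 1) / (2 * (x - 1)) -
            Real.log x / ((x - 1) * (x - 3)) = 3 / (x * (x - 1) * (x - 3)) := by
          field_simp
          ring
        rw [this]
        positivity
    _ ≤ _ := by gcongr

lemma sum_primeWeight_range_le : ∑ n ∈ Finset.range 73, primeWeight n ≤
    0.34 - (Real.log 73 + 1) / (2 * 70) := by
  have hfilter : (Finset.range 73).filter (fun n => n.Prime ∧ 5 ≤ n) =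
      {5, 7, 11, 13, 17, 19, 23, 29, 31, 37, 41, 43, 47, 53, 59, 61, 67, 71} := by decide +kernel
  simp only [primeWeight]
  rw [← Finset.sum_filter, hfilter]
  have h5 := log_le_of_pow_le (p := 5) (k := 31) (m := 72) (b := 1.6099)
    (by norm_num) (by norm_num) (by norm_num)
  have h7 := log_le_of_pow_le (p := 7) (k := 26) (m := 73) (b := 1.9462)
    (by norm_num) (by norm_num) (by norm_num)
  have h11 := log_le_of_pow_le (p := 11) (k := 13) (m := 45) (b := 2.3994)
    (by norm_num) (by norm_num) (by norm_num)
  have h13 := log_le_of_pow_le (p := 13) (k := 17) (m := 63) (b := 2.5688)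
    (by norm_num) (by norm_num) (by norm_num)
  have h17 := log_le_of_pow_le (p := 17) (k := 11) (m := 45) (b := 2.8357)
    (by norm_num) (by norm_num) (by norm_num)
  have h19 := log_le_of_pow_le (p := 19) (k := 4) (m := 17) (b := 2.9459)
    (by norm_num) (by norm_num) (by norm_num)
  have h23 := log_le_of_pow_le (p := 23) (k := 11) (m := 50) (b := 3.1507)
    (by norm_num) (by norm_num) (by norm_num)
  have h29 := log_le_of_pow_le (p := 29) (k := 8) (m := 39) (b := 3.3791)
    (by norm_num) (by norm_num) (by norm_num)
  have h31 := log_le_of_pow_le (p := 31) (k := 1) (m := 5) (b := 3.4658)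
    (by norm_num) (by norm_num) (by norm_num)
  have h37 := log_le_of_pow_le (p := 37) (k := 9) (m := 47) (b := 3.6198)
    (by norm_num) (by norm_num) (by norm_num)
  have h41 := log_le_of_pow_le (p := 41) (k := 11) (m := 59) (b := 3.7178)
    (by norm_num) (by norm_num) (by norm_num)
  have h43 := log_le_of_pow_le (p := 43) (k := 7) (m := 38) (b := 3.7628)
    (by norm_num) (by norm_num) (by norm_num)
  have h47 := log_le_of_pow_le (p := 47) (k := 9) (m := 50) (b := 3.8509)
    (by norm_num) (by norm_num) (by norm_num)
  have h53 := log_le_of_pow_le (p := 53) (k := 4) (m := 23) (b := 3.9856)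
    (by norm_num) (by norm_num) (by norm_num)
  have h59 := log_le_of_pow_le (p := 59) (k := 9) (m := 53) (b := 4.0819)
    (by norm_num) (by norm_num) (by norm_num)
  have h61 := log_le_of_pow_le (p := 61) (k := 1) (m := 6) (b := 4.1589)
    (by norm_num) (by norm_num) (by norm_num)
  have h67 := log_le_of_pow_le (p := 67) (k := 11) (m := 67) (b := 4.2219)
    (by norm_num) (by norm_num) (by norm_num)
  have h71 := log_le_of_pow_le (p := 71) (k := 6) (m := 37) (b := 4.2745)
    (by norm_num) (by norm_num) (by norm_num)
  have h73 := log_le_of_pow_le (p := 73) (k := 5) (m := 31) (b := 4.2976)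
    (by norm_num) (by norm_num) (by norm_num)
  norm_num [Finset.sum_insert, Finset.sum_singleton] at *
  linarith

lemma sum_primeWeight_le (N : ℕ) : ∑ n ∈ Finset.range N, primeWeight n ≤ 0.34 := by
  have key : ∀ k : ℕ, ∑ n ∈ Finset.range (73 + 2 * k), primeWeight n ≤
      0.34 - (Real.log (73 + 2 * k) + 1) / (2 * (70 + 2 * k)) := by
    intro k
    induction k with
    | zero => simpa using sum_primeWeight_range_le
    | succ k ih =>
      rw [show 73 + 2 * (k + 1) = 73 + 2 * k + 1 + 1 by ring, Finset.sum_range_succ,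
        Finset.sum_range_succ]
      have heven : primeWeight (73 + 2 * k + 1) = 0 := by
        refine if_neg fun h => ?_
        have := h.1.eq_two_or_odd
        omega
      have hodd : primeWeight (73 + 2 * k) ≤
          (Real.log (73 + 2 * k) + 1) / (2 * (70 + 2 * k)) -
            (Real.log (73 + 2 * k + 2) + 1) / (2 * (72 + 2 * k)) := by
        have h := log_div_le_telescope (x := 73 + 2 * k)
          (by linarith [k.cast_nonneg (α := ℝ)])
        rw [show (73 : ℝ) + 2 * k - 3 = 70 + 2 * k by ring,
          show (73 : ℝ) + 2 * k - 1 = 72 + 2 * k by ring] at h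
        refine le_trans ?_ h
        unfold primeWeight
        split_ifs with hp
        · push_cast
          rw [show (73 : ℝ) + 2 * k - 1 = 72 + 2 * k by ring]
        · have := Real.log_nonneg (x := (73 : ℝ) + 2 * k) (by linarith [k.cast_nonneg (α := ℝ)])
          have h2 : (0 : ℝ) ≤ 73 + 2 * k - 2 := by linarith [k.cast_nonneg (α := ℝ)]
          positivity
      push_cast
      rw [heven, show (73 : ℝ) + 2 * (k + 1) = 73 + 2 * k + 2 by ring,
        show (70 : ℝ) + 2 * (k + 1) = 72 + 2 * k by ring]
      linarith
  have h1 : ∑ n ∈ Finset.range N, primeWeight n ≤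
      ∑ n ∈ Finset.range (73 + 2 * N), primeWeight n :=
    Finset.sum_le_sum_of_subset_of_nonneg (Finset.range_mono (by omega))
      fun n _ _ => primeWeight_nonneg n
  have h2 : 0 ≤ (Real.log (73 + 2 * N) + 1) / (2 * (70 + 2 * N)) := by
    have := Real.log_nonneg (x := (73 : ℝ) + 2 * N) (by linarith [N.cast_nonneg (α := ℝ)])
    positivity
  linarith [key N]

/-- Secant bounds for `x ↦ m ^ x` on `[0, 1]` and `[1, 2]`, in terms of `a ≤ m ^ k`. -/
lemma rpow_le_secant {a m v : ℝ} {k : ℕ} (ha : 0 ≤ a) (hm : 0 < m) (ham : a ≤ m ^ k)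
    (hv : 0 ≤ v) :
    (k * v ≤ 1 → a ^ v ≤ 1 + k * v * (m - 1)) ∧
      (1 ≤ k * v → k * v ≤ 2 → a ^ v ≤ m * (1 + (k * v - 1) * (m - 1))) := by
  have h : a ^ v ≤ m ^ (k * v) := by
    rw [Real.rpow_mul hm.le, Real.rpow_natCast]
    exact Real.rpow_le_rpow ha ham hv
  have bern : ∀ w : ℝ, 0 ≤ w → w ≤ 1 → m ^ w ≤ 1 + w * (m - 1) := fun w h0 h1 => by
    simpa using rpow_one_add_le_one_add_mul_self (s := m - 1) (by linarith) h0 h1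
  refine ⟨fun h1 => h.trans (bern _ (by positivity) h1), fun h1 h2 => h.trans ?_⟩
  rw [show (k * v : ℝ) = 1 + (k * v - 1) by ring, Real.rpow_add hm, Real.rpow_one]
  have := mul_le_mul_of_nonneg_left (bern (k * v - 1) (by linarith) (by linarith)) hm.le
  simpa using this

lemma logsum_error_le {u : ℝ} (hu : 0 < u) (hu1 : u ≤ 1) :
    Real.log 2 / 2 ^ (1 + u) + Real.log 3 / 3 ^ (1 + u) +
        3 ^ (-u) * (Real.log 3 / u + 1 / u ^ 2) - 1 / u ^ 2 ≤
      0.3466 * (1 - u / 2) - (0.2372 + 0.2209 * u + 0.06 * u ^ 2) / (1 + 2 * u) := by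
  have hl := Real.log_three_gt_d9
  have hl' := Real.log_three_lt_d9
  have h2 := Real.log_two_lt_d9
  have hb1 : (3 : ℝ) ^ u ≤ 1 + 2 * u := by
    have := rpow_one_add_le_one_add_mul_self (s := 2) (by norm_num) hu.le hu1
    norm_num at this
    linarith
  have hhalf : ((2 : ℝ) ^ u)⁻¹ ≤ 1 - u / 2 := by
    have := rpow_one_add_le_one_add_mul_self (s := -1 / 2) (by norm_num) hu.le hu1
    rw [← Real.inv_rpow (by norm_num)]
    norm_num at this ⊢
    linarith
  have hexp : 1 + Real.log 3 * u + (Real.log 3 * u) ^ 2 / 2 + (Real.log 3 * u) ^ 3 / 6 +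
      (Real.log 3 * u) ^ 4 / 24 ≤ 3 ^ u := by
    have := Real.sum_le_exp_of_nonneg (x := Real.log 3 * u) (by positivity) 5
    rw [Real.rpow_def_of_pos (by norm_num)]
    simpa [Finset.sum_range_succ, Nat.factorial] using this
  have hb : (0 : ℝ) < 3 ^ u := by positivity
  rw [Real.rpow_add (by norm_num), Real.rpow_add (by norm_num), Real.rpow_neg (by norm_num),
    Real.rpow_one, Real.rpow_one]
  generalize (3 : ℝ) ^ u = b at *
  generalize Real.log 3 = l at *
  have e1 : l / (3 * b) + b⁻¹ * (l / u + 1 / u ^ 2) - 1 / u ^ 2 =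
      l / (3 * b) - (b - 1 - l * u) / (u ^ 2 * b) := by
    field_simp
    ring
  have e2 : (l ^ 2 / 2 + l ^ 3 * u / 6 + l ^ 4 * u ^ 2 / 24) / b ≤
      (b - 1 - l * u) / (u ^ 2 * b) := by
    rw [← div_div]
    gcongr
    rw [le_div_iff₀ (by positivity)]
    nlinarith
  have hl0 : 0 ≤ l := by linarith
  have l2 : 1.0986 ^ 2 ≤ l ^ 2 := by gcongr; linarith
  have l3 : 1.0986 ^ 3 ≤ l ^ 3 := by gcongr; linarith
  have l4 : 1.0986 ^ 4 ≤ l ^ 4 := by gcongr; linarith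
  have e3 : (0.2372 + 0.2209 * u + 0.06 * u ^ 2) / (1 + 2 * u) ≤
      (l ^ 2 / 2 + l ^ 3 * u / 6 + l ^ 4 * u ^ 2 / 24 - l / 3) / b := by
    have : 0.2372 + 0.2209 * u + 0.06 * u ^ 2 ≤
        l ^ 2 / 2 + l ^ 3 * u / 6 + l ^ 4 * u ^ 2 / 24 - l / 3 := by
      have a3 : 0.2209 * u ≤ l ^ 3 / 6 * u := by gcongr; linarith
      have a4 : 0.06 * u ^ 2 ≤ l ^ 4 / 24 * u ^ 2 := by gcongr; linarith
      linarith
    gcongr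
    exact le_trans (by positivity) this
  rw [sub_div, div_div] at e3
  have e4 : Real.log 2 / (2 * 2 ^ u) ≤ 0.3466 * (1 - u / 2) := by
    rw [← div_div, div_eq_mul_inv]
    gcongr
    linarith
  linarith

lemma le_one_div_sub_of_mul_le {u V Z E : ℝ} (hu : 0 < u) (hZ : 1 / u + 1 / 2 ≤ Z) (hV : 0 ≤ V)
    (hVZ : V * Z ≤ 1 / u ^ 2 + E) : V ≤ 1 / u - (1 - 2 * u * E) / (2 + u) := by
  have h := (mul_le_mul_of_nonneg_left hZ hV).trans hVZ
  have e : 1 / u - (1 - 2 * u * E) / (2 + u) = (1 / u ^ 2 + E) / (1 / u + 1 / 2) := by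
    field_simp
    ring
  rw [e, le_div_iff₀ (by positivity)]
  exact h

lemma prime_correction_le {u : ℝ} (hu : 0 < u) (hu1 : u ≤ 1) :
    3 ^ (-(u / 2)) * 0.92 ≤
      (1 - 2 * u * (0.3466 * (1 - u / 2) -
        (0.2372 + 0.2209 * u + 0.06 * u ^ 2) / (1 + 2 * u))) / (2 + u) +
        Real.log 2 / (2 ^ (1 + u) - 1) := by
  have hr := rpow_le_secant (a := 1 / 3) (m := 0.7599) (v := u / 2) (k := 4)
    (by norm_num) (by norm_num) (by norm_num) (by positivity)
  have ht := rpow_le_secant (a := 2) (m := 1.4143) (v := u) (k := 2)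
    (by norm_num) (by norm_num) (by norm_num) hu.le
  have h2 := Real.log_two_gt_d9
  have ht1 : (1 : ℝ) < 2 ^ u := Real.one_lt_rpow (by norm_num) hu
  rw [Real.rpow_neg (by norm_num), ← Real.inv_rpow (by norm_num), inv_eq_one_div,
    Real.rpow_add (by norm_num), Real.rpow_one]
  push_cast at hr ht
  generalize (2 : ℝ) ^ u = t at *
  generalize (1 / 3 : ℝ) ^ (u / 2) = r at *
  rcases le_total u (1 / 2) with h | h
  · have hr' := hr.1 (by linarith)
    have ht' := ht.1 (by linarith)
    have he : 0.3466 * (1 - u / 2) -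
        (0.2372 + 0.2209 * u + 0.06 * u ^ 2) / (1 + 2 * u) ≤ 0.142 - 0.12 * u := by
      rw [sub_le_iff_le_add, ← sub_le_iff_le_add', le_div_iff₀ (by positivity)]
      nlinarith
    have hlog : 0.6931 / (2 * (1 + 2 * u * (1.4143 - 1)) - 1) ≤ Real.log 2 / (2 * t - 1) := by
      gcongr
      · linarith
      · linarith
    have hE : (1 - 2 * u * (0.142 - 0.12 * u)) / (2 + u) ≤ (1 - 2 * u * (0.3466 * (1 - u / 2) -
        (0.2372 + 0.2209 * u + 0.06 * u ^ 2) / (1 + 2 * u))) / (2 + u) := by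
      gcongr
    have hfin : (1 + 2 * u * (0.7599 - 1)) * 0.92 ≤ (1 - 2 * u * (0.142 - 0.12 * u)) / (2 + u) +
        0.6931 / (2 * (1 + 2 * u * (1.4143 - 1)) - 1) := by
      have hd : (0 : ℝ) < 2 * (1 + 2 * u * (1.4143 - 1)) - 1 := by linarith
      rw [div_add_div _ _ (by positivity) hd.ne', le_div_iff₀ (by positivity)]
      nlinarith [mul_nonneg hu.le (sub_nonneg.mpr h),
        mul_nonneg (mul_nonneg hu.le hu.le) (sub_nonneg.mpr h)]
    linarith
  · have hr' := hr.2 (by linarith) (by linarith)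
    have ht' := ht.2 (by linarith) (by linarith)
    have he : 0.3466 * (1 - u / 2) -
        (0.2372 + 0.2209 * u + 0.06 * u ^ 2) / (1 + 2 * u) ≤ 0.16 - 0.15 * u := by
      rw [sub_le_iff_le_add, ← sub_le_iff_le_add', le_div_iff₀ (by positivity)]
      nlinarith
    have hlog : 0.6931 / (2 * (1.4143 * (1 + (2 * u - 1) * (1.4143 - 1))) - 1) ≤
        Real.log 2 / (2 * t - 1) := by
      gcongr
      · linarith
      · linarith
    have hE : (1 - 2 * u * (0.16 - 0.15 * u)) / (2 + u) ≤ (1 - 2 * u * (0.3466 * (1 - u / 2) -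
        (0.2372 + 0.2209 * u + 0.06 * u ^ 2) / (1 + 2 * u))) / (2 + u) := by
      gcongr
    have hfin : 0.7599 * (1 + (2 * u - 1) * (0.7599 - 1)) * 0.92 ≤
        (1 - 2 * u * (0.16 - 0.15 * u)) / (2 + u) +
        0.6931 / (2 * (1.4143 * (1 + (2 * u - 1) * (1.4143 - 1))) - 1) := by
      have hd : (0 : ℝ) < 2 * (1.4143 * (1 + (2 * u - 1) * (1.4143 - 1))) - 1 := by linarith
      rw [div_add_div _ _ (by positivity) hd.ne', le_div_iff₀ (by positivity)]
      nlinarith [mul_nonneg (sub_nonneg.mpr hu1) (sub_nonneg.mpr h),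
        mul_nonneg hu.le (mul_nonneg (sub_nonneg.mpr hu1) (sub_nonneg.mpr h)),
        mul_nonneg hu.le (sq_nonneg (u - 0.8))]
    linarith

/-- The summand of the odd prime sum with exponent `u`. -/
noncomputable def oddPrimeTerm (u : ℝ) (p : ℕ) : ℝ :=
  if p.Prime ∧ 3 ≤ p then Real.log p / (((p : ℝ) - 2) * (p : ℝ) ^ u) else 0

lemma oddPrimeTerm_nonneg (u : ℝ) (n : ℕ) : 0 ≤ oddPrimeTerm u n := by
  unfold oddPrimeTerm
  split_ifs with h
  · have : (3 : ℝ) ≤ n := by exact_mod_cast h.2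
    exact div_nonneg (Real.log_natCast_nonneg n) (mul_nonneg (by linarith) (by positivity))
  · exact le_rfl

lemma summable_primeWeight : Summable primeWeight :=
  summable_of_sum_range_le primeWeight_nonneg sum_primeWeight_le

lemma tsum_primeWeight_le : ∑' n, primeWeight n ≤ 0.34 :=
  Real.tsum_le_of_sum_range_le primeWeight_nonneg sum_primeWeight_le

/-- The majorant of the correction from `p ^ (1 + u) - 1` to `p ^ (1 + u) - 2 p ^ u`. -/
noncomputable def correctionWeight (n : ℕ) : ℝ :=
  (if n = 3 then Real.log 3 / 2 else 0) + 1.09 * primeWeight n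

lemma hasSum_correctionWeight :
    HasSum correctionWeight (Real.log 3 / 2 + 1.09 * ∑' n, primeWeight n) :=
  (hasSum_ite_eq 3 (Real.log 3 / 2)).add (summable_primeWeight.hasSum.mul_left 1.09)

lemma correctionWeight_total_le : Real.log 3 / 2 + 1.09 * ∑' n, primeWeight n ≤ 0.92 := by
  linarith [tsum_primeWeight_le, Real.log_three_lt_d9]

lemma mul_oddPrimeTerm_le_correctionWeight {u : ℝ} (hu : 1 ≤ u) (n : ℕ) :
    u * oddPrimeTerm u n ≤ correctionWeight n := by
  have hw := primeWeight_nonneg n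
  by_cases h : n.Prime ∧ 3 ≤ n
  · have hn : (3 : ℝ) ≤ n := by exact_mod_cast h.2
    have hn2 : 0 < (n : ℝ) - 2 := by linarith
    have hlog := Real.log_natCast_nonneg n
    have hun : u * n ≤ (n : ℝ) ^ u := by
      have hlog1 : 1 ≤ Real.log n := by
        have := Real.log_le_log (by norm_num) hn
        linarith [Real.log_three_gt_d9]
      have hexp := Real.add_one_le_exp (Real.log n * (u - 1))
      rw [← Real.rpow_def_of_pos (by linarith), Real.rpow_sub_one (by linarith)] at hexp
      rw [← le_div_iff₀ (by linarith)]
      nlinarith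
    have hterm : u * oddPrimeTerm u n ≤ Real.log n / (((n : ℝ) - 2) * n) := by
      rw [oddPrimeTerm, if_pos h, ← mul_div_assoc, div_le_div_iff₀ (by positivity) (by positivity)]
      nlinarith [mul_le_mul_of_nonneg_left hun (mul_nonneg hlog hn2.le)]
    refine hterm.trans ?_
    rcases h.2.eq_or_lt with rfl | h4
    · norm_num [correctionWeight, primeWeight] at *
      linarith
    · have h5 : 5 ≤ n := by
        by_contra h'
        have : n = 4 := by omega
        subst this
        norm_num at h
      have : Real.log n / (((n : ℝ) - 2) * n) ≤ primeWeight n := by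
        rw [primeWeight, if_pos ⟨h.1, h5⟩]
        refine div_le_div_of_nonneg_left hlog (mul_pos (by linarith) hn2) ?_
        nlinarith
      simp only [correctionWeight, h4.ne', if_false]
      linarith
  · have := Real.log_nonneg (x := 3) (by norm_num)
    simp only [oddPrimeTerm, h, if_false, mul_zero, correctionWeight]
    positivity

lemma correction_three_le {y : ℝ} (hy : 0 < y) (h1 : 1 ≤ y ^ 2) :
    1 / y ^ 2 - 1 / (3 * y ^ 2 - 1) ≤ 1 / 2 * y⁻¹ := by
  have hd : 0 < 3 * y ^ 2 - 1 := by linarith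
  rw [← sub_nonneg]
  have : 1 / 2 * y⁻¹ - (1 / y ^ 2 - 1 / (3 * y ^ 2 - 1)) =
      (y - 1) ^ 2 * (3 * y + 2) / (2 * y ^ 2 * (3 * y ^ 2 - 1)) := by
    generalize hD : 3 * y ^ 2 - 1 = d at *
    field_simp
    rw [← hD]
    ring
  rw [this]
  positivity

lemma correction_le {x y : ℝ} (hx : 2 < x) (hy : 0 < y) (h1 : 1 ≤ y ^ 2) :
    1 / ((x - 2) * y ^ 2) - 1 / (x * y ^ 2 - 1) ≤ 1.09 / ((x - 1) * (x - 2)) * y⁻¹ := by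
  have h2 : 0 < x - 2 := by linarith
  have h3 : 0 < x - 1 := by linarith
  have h4 : (x - 1) * y ^ 2 ≤ x * y ^ 2 - 1 := by linarith
  have h5 : 0 < (x - 1) * y ^ 2 := by positivity
  have h6 : 0 < x * y ^ 2 - 1 := h5.trans_le h4
  calc 1 / ((x - 2) * y ^ 2) - 1 / (x * y ^ 2 - 1)
      = (2 * y ^ 2 - 1) / ((x - 2) * y ^ 2 * (x * y ^ 2 - 1)) := by
        field_simp
        ring
    _ ≤ (1.09 * y ^ 3) / ((x - 2) * y ^ 2 * ((x - 1) * y ^ 2)) := by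
        have : 2 * y ^ 2 - 1 ≤ 1.09 * y ^ 3 := by
          nlinarith [mul_nonneg hy.le (sq_nonneg (y - 1.22)), sq_nonneg (y - 1.22)]
        gcongr
    _ = 1.09 / ((x - 1) * (x - 2)) * y⁻¹ := by
        field_simp

lemma oddPrimeTerm_le {u : ℝ} (hu : 0 < u) (n : ℕ) :
    oddPrimeTerm u n + (if n = 2 then Real.log 2 / (2 ^ (1 + u) - 1) else 0) ≤
      (if n.Prime then Real.log n / ((n : ℝ) ^ (1 + u) - 1) else 0) +
        3 ^ (-(u / 2)) * correctionWeight n := by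
  have hc : 0 ≤ correctionWeight n := by
    have := primeWeight_nonneg n
    have := Real.log_nonneg (x := 3) (by norm_num)
    unfold correctionWeight
    positivity
  have hc' : 0 ≤ 3 ^ (-(u / 2)) * correctionWeight n := by positivity
  by_cases hp : n.Prime
  · rcases hp.two_le.eq_or_lt with rfl | h3
    · simpa [oddPrimeTerm, hp] using hc'
    · have h3' : 3 ≤ n := h3
      have hn : (3 : ℝ) ≤ n := by exact_mod_cast h3'
      have hn0 : (0 : ℝ) < n := by linarith
      set y := (n : ℝ) ^ (u / 2) with hy
      have hy0 : 0 < y := by positivity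
      have hy2 : (n : ℝ) ^ u = y ^ 2 := by
        rw [hy, ← Real.rpow_mul_natCast hn0.le]
        simp
      have h1 : 1 ≤ y ^ 2 := hy2 ▸ Real.one_le_rpow (by linarith) hu.le
      have hlog := Real.log_natCast_nonneg n
      have hyinv : y⁻¹ ≤ 3 ^ (-(u / 2)) := by
        rw [Real.rpow_neg (by norm_num), hy]
        gcongr
      simp only [oddPrimeTerm, hp, h3', and_self, if_true, h3.ne', if_false, add_zero,
        Real.rpow_add hn0, Real.rpow_one, hy2]
      rw [← sub_le_iff_le_add']
      rcases h3'.eq_or_lt with rfl | h4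
      · have h := mul_le_mul_of_nonneg_left (correction_three_le hy0 h1) hlog
        have h' : Real.log 3 / 2 * y⁻¹ ≤ Real.log 3 / 2 * 3 ^ (-(u / 2)) := by
          gcongr
        norm_num [correctionWeight, primeWeight] at *
        simp only [div_eq_mul_inv] at *
        linarith
      · have h5 : 5 ≤ n := by
          by_contra h
          have : n = 4 := by omega
          subst this
          norm_num at hp
        have h := mul_le_mul_of_nonneg_left (correction_le (by linarith : (2 : ℝ) < n) hy0 h1) hlog
        have hcw : correctionWeight n =
            Real.log n * (1.09 / (((n : ℝ) - 1) * ((n : ℝ) - 2))) := by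
          simp only [correctionWeight, primeWeight, hp, h5, and_self, if_true, h4.ne', if_false]
          ring
        have h' := mul_le_mul_of_nonneg_right hyinv hc
        rw [hcw] at h' ⊢
        refine le_trans (le_of_eq ?_) ((h.trans (le_of_eq ?_)).trans h') <;> ring
  · have h2 : n ≠ 2 := fun h => hp (h ▸ Nat.prime_two)
    simpa [oddPrimeTerm, hp, h2] using hc'

lemma tsum_oddPrimeTerm_le {u : ℝ} (hu : 0 < u) :
    ∑' n, oddPrimeTerm u n ≤ ∑' n : ℕ, Λ n / (n : ℝ) ^ (1 + u) -
      Real.log 2 / (2 ^ (1 + u) - 1) + 3 ^ (-(u / 2)) * 0.92 := by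
  have hmaj := (hasSum_prime_log_div_rpow_sub_one (s := 1 + u) (by linarith)).add
    (hasSum_correctionWeight.mul_left (3 ^ (-(u / 2))))
  have htwo := hasSum_ite_eq 2 (Real.log 2 / ((2 : ℝ) ^ (1 + u) - 1))
  have hodd : Summable (oddPrimeTerm u) := by
    refine Summable.of_nonneg_of_le (oddPrimeTerm_nonneg u) (fun n => ?_) hmaj.summable
    refine le_trans (le_add_of_nonneg_right ?_) (oddPrimeTerm_le hu n)
    have : (1 : ℝ) < 2 ^ (1 + u) := Real.one_lt_rpow (by norm_num) (by linarith)
    have := sub_pos.mpr this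
    positivity
  have h := hasSum_le (oddPrimeTerm_le hu) (hodd.hasSum.add htwo) hmaj
  have := mul_le_mul_of_nonneg_left correctionWeight_total_le
    (show (0 : ℝ) ≤ 3 ^ (-(u / 2)) by positivity)
  linarith

theorem odd_prime_sum_bound (u : ℝ) (hu : 0 < u) :
    u * (∑' p : ℕ, if p.Prime ∧ 3 ≤ p then
        Real.log p / (((p : ℝ) - 2) * (p : ℝ) ^ u) else 0) ≤ 1 := by
  change u * ∑' p, oddPrimeTerm u p ≤ 1
  rcases le_total u 1 with hu1 | hu1
  · have hV : 0 ≤ ∑' n : ℕ, Λ n / (n : ℝ) ^ (1 + u) := tsum_nonneg fun n =>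
      div_nonneg ArithmeticFunction.vonMangoldt_nonneg (by positivity)
    have hlog := tsum_log_div_rpow_le hu
    rw [← tsum_vonMangoldt_mul_tsum (by linarith)] at hlog
    have herr := logsum_error_le hu hu1
    have hbound := le_one_div_sub_of_mul_le hu (one_div_add_half_le_tsum hu) hV
      (hlog.trans (sub_le_iff_le_add'.mp herr))
    have hodd := tsum_oddPrimeTerm_le hu
    have hcorr := prime_correction_le hu hu1
    rw [← le_div_iff₀' hu]
    linarith
  · rw [← tsum_mul_left]
    refine le_trans (Summable.tsum_le_tsum (mul_oddPrimeTerm_le_correctionWeight hu1) ?_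
      hasSum_correctionWeight.summable) ?_
    · exact Summable.of_nonneg_of_le
        (fun n => mul_nonneg hu.le (oddPrimeTerm_nonneg u n))
        (mul_oddPrimeTerm_le_correctionWeight hu1) hasSum_correctionWeight.summable
    · rw [hasSum_correctionWeight.tsum_eq]
      linarith [correctionWeight_total_le]
end

section
/- Let $m > 1$ be a natural number all of whose prime factors are odd. Set $L := \log m$, $\beta_p := \frac{p}{p-2}$ for odd primes $p$, and $\lambda := \sum_{p \mid m} v_p(m)\, \beta_p \log p$, where $v_p(m)$ is the exponent of $p$ in $m$. Then $\sum_{p \geq 3\ \mathrm{prime}} \frac{L\, (v_p(m) + 1)\, \beta_p \log p}{p\,(L + \log p)\,(\lambda + \beta_p \log p)} \leq 1$. (This is the sub-invariance inequality for the doubly harmonic weight with respect to the weighted prime-division downward chain used in the proof of the odd Banks–Martin conjecture.) -/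
open Real Finset

/-- The trapezoid rule overestimates the integral of `x ^ (-(1 + u))`. -/
lemma rpow_neg_div_sub_le_trapezoid {u x : ℝ} (hu : 0 < u) (hx : 0 < x) :
    x ^ (-u) / u - (x + 2) ^ (-u) / u ≤ x ^ (-(1 + u)) + (x + 2) ^ (-(1 + u)) := by
  set φ : ℝ → ℝ := fun y => (x ^ (-(1 + u)) + y ^ (-(1 + u))) * ((y - x) / 2) + y ^ (-u) / u
    with hφ
  have hd : ∀ y : ℝ, 0 < y → HasDerivAt φ
      ((-(1 + u) * y ^ (-(1 + u) - 1)) * ((y - x) / 2)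
        + (x ^ (-(1 + u)) + y ^ (-(1 + u))) * (1 / 2) + (-u * y ^ (-u - 1)) / u) y := by
    intro y hy
    have h1 := (hasDerivAt_rpow_const (x := y) (p := -(1 + u)) (Or.inl hy.ne')).const_add
      (x ^ (-(1 + u)))
    have h2 := ((hasDerivAt_id y).sub_const x).div_const 2
    have h3 := (hasDerivAt_rpow_const (x := y) (p := -u) (Or.inl hy.ne')).div_const u
    exact (h1.mul h2).add h3
  have hmono : MonotoneOn φ (Set.Ici x) := by
    apply monotoneOn_of_deriv_nonneg (convex_Ici x)
    · exact fun y hy => (hd y (hx.trans_le hy)).continuousAt.continuousWithinAt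
    · intro y hy
      rw [interior_Ici] at hy
      exact (hd y (hx.trans hy)).differentiableAt.differentiableWithinAt
    · intro y hy
      rw [interior_Ici] at hy
      have hy0 : 0 < y := hx.trans hy
      rw [(hd y hy0).deriv]
      have e1 : y ^ (-(1 + u) - 1) = y ^ (-(1 + u)) / y := by rw [rpow_sub_one hy0.ne']
      have e2 : y ^ (-u - 1) = y ^ (-(1 + u)) := by congr 1; ring
      have hY : 0 < y ^ (-(1 + u)) := rpow_pos_of_pos hy0 _
      have key : y ^ (-(1 + u)) * (1 + (1 + u) * (1 - x / y)) ≤ x ^ (-(1 + u)) := by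
        have h1 : x ^ (-(1 + u)) = y ^ (-(1 + u)) * exp ((1 + u) * log (y / x)) := by
          rw [rpow_def_of_pos hx, rpow_def_of_pos hy0, ← exp_add, log_div hy0.ne' hx.ne']
          congr 1; ring
        rw [h1]
        apply mul_le_mul_of_nonneg_left _ hY.le
        have h2 := one_sub_inv_le_log_of_pos (div_pos hy0 hx)
        rw [inv_div] at h2
        have h3 := add_one_le_exp ((1 + u) * log (y / x))
        nlinarith
      rw [e1, e2]
      have e3 : -u * y ^ (-(1 + u)) / u = - y ^ (-(1 + u)) := by field_simp
      have e4 : -(1 + u) * (y ^ (-(1 + u)) / y) * ((y - x) / 2)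
          = -(y ^ (-(1 + u)) * ((1 + u) * (1 - x / y))) / 2 := by field_simp
      rw [e3, e4]
      nlinarith
  have h := hmono (Set.mem_Ici.2 le_rfl) (Set.mem_Ici.2 (by linarith : x ≤ x + 2)) (by linarith)
  simp only [hφ] at h
  ring_nf at h ⊢
  linarith

/-- An antiderivative of `log x * x ^ (-(1 + u))`, up to sign. -/
noncomputable def logRpowTail (u x : ℝ) : ℝ := x ^ (-u) * (log x / u + 1 / u ^ 2)

lemma logRpowTail_nonneg {u x : ℝ} (hu : 0 < u) (hx : 1 ≤ x) : 0 ≤ logRpowTail u x := by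
  have := log_nonneg hx
  unfold logRpowTail
  positivity

lemma hasDerivAt_logRpowTail {u x : ℝ} (hu : 0 < u) (hx : 0 < x) :
    HasDerivAt (logRpowTail u) (-(log x * x ^ (-(1 + u)))) x := by
  have h1 := hasDerivAt_rpow_const (x := x) (p := -u) (Or.inl hx.ne')
  have h2 := ((hasDerivAt_log hx.ne').div_const u).add_const (1 / u ^ 2)
  convert! h1.mul h2 using 1
  have e2 : x ^ (-u - 1) = x ^ (-(1 + u)) := by congr 1; ring
  have e3 : x ^ (-u) = x ^ (-(1 + u)) * x := by
    rw [← rpow_add_one hx.ne']; congr 1; ring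
  rw [e2, e3]
  field_simp
  ring

lemma two_mul_log_mul_rpow_le {u x : ℝ} (hu : 0 < u) (hx : 3 ≤ x) :
    2 * (log (x + 2) * (x + 2) ^ (-(1 + u))) ≤ logRpowTail u x - logRpowTail u (x + 2) := by
  have hpos : ∀ y ∈ Set.Icc x (x + 2), 0 < y := fun y hy => by linarith [hy.1]
  obtain ⟨c, hc, hc'⟩ := exists_deriv_eq_slope (logRpowTail u) (by linarith : x < x + 2)
    (fun y hy => (hasDerivAt_logRpowTail hu (hpos y hy)).continuousAt.continuousWithinAt)
    (fun y hy => (hasDerivAt_logRpowTail hu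
      (hpos y (Set.Ioo_subset_Icc_self hy))).differentiableAt.differentiableWithinAt)
  have hc0 : 0 < c := by linarith [hc.1]
  rw [(hasDerivAt_logRpowTail hu hc0).deriv] at hc'
  have hanti := log_div_self_rpow_antitoneOn (a := 1 + u) (by linarith)
  have he : exp (1 + u)⁻¹ ≤ 3 := by
    have : exp (1 + u)⁻¹ ≤ exp 1 := exp_le_exp.2 (inv_le_one_of_one_le₀ (by linarith))
    linarith [exp_one_lt_d9]
  have h := hanti (a := c) (b := x + 2) (by simp only [Set.mem_Ici]; linarith [hc.1])
    (by simp only [Set.mem_Ici]; linarith) hc.2.le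
  simp only [div_eq_mul_inv] at h
  rw [← rpow_neg (by linarith), ← rpow_neg hc0.le] at h
  have : (x + 2 - x) = 2 := by ring
  rw [this] at hc'
  field_simp at hc'
  linarith

lemma sum_range_log_mul_rpow_le {u : ℝ} (hu : 0 < u) (n : ℕ) :
    ∑ k ∈ range n, log (2 * k + 1 : ℝ) * (2 * k + 1 : ℝ) ^ (-(1 + u)) ≤
      log 3 * (3 : ℝ) ^ (-(1 + u)) + logRpowTail u 3 / 2 := by
  have h : ∀ n : ℕ, ∑ k ∈ range (n + 2), log (2 * k + 1 : ℝ) * (2 * k + 1 : ℝ) ^ (-(1 + u)) ≤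
      log 3 * (3 : ℝ) ^ (-(1 + u)) + logRpowTail u 3 / 2 - logRpowTail u (2 * n + 3) / 2 := by
    intro n
    induction n with
    | zero => simp [sum_range_succ]; norm_num
    | succ n ih =>
      rw [sum_range_succ]
      have := two_mul_log_mul_rpow_le (x := 2 * n + 3) hu (by linarith [n.cast_nonneg (α := ℝ)])
      push_cast at ih ⊢
      have e : (2 * (n : ℝ) + 3 + 2) = 2 * (n + 2) + 1 := by ring
      have e' : 2 * ((n : ℝ) + 1) + 3 = 2 * (n + 2) + 1 := by ring
      rw [e] at this
      rw [e']
      linarith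
  have hn := logRpowTail_nonneg (x := 2 * n + 3) hu (by linarith [n.cast_nonneg (α := ℝ)])
  refine le_trans (sum_le_sum_of_subset_of_nonneg (range_mono (by omega : n ≤ n + 2)) ?_)
    ((h n).trans (by linarith))
  intro k _ _
  have := log_nonneg (x := 2 * k + 1) (by linarith [k.cast_nonneg (α := ℝ)])
  positivity

lemma summable_odd_log_mul_rpow {u : ℝ} (hu : 0 < u) :
    Summable fun k : ℕ => log (2 * k + 1 : ℝ) * (2 * k + 1 : ℝ) ^ (-(1 + u)) := by
  refine summable_of_sum_range_le (fun k => ?_) (sum_range_log_mul_rpow_le hu)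
  have := log_nonneg (x := 2 * k + 1) (by linarith [k.cast_nonneg (α := ℝ)])
  positivity

lemma tsum_odd_log_mul_rpow_le {u : ℝ} (hu : 0 < u) :
    ∑' k : ℕ, log (2 * k + 1 : ℝ) * (2 * k + 1 : ℝ) ^ (-(1 + u)) ≤
      log 3 * (3 : ℝ) ^ (-(1 + u)) + logRpowTail u 3 / 2 :=
  (summable_odd_log_mul_rpow hu).tsum_le_of_sum_range_le (sum_range_log_mul_rpow_le hu)

lemma summable_odd_rpow {u : ℝ} (hu : 0 < u) :
    Summable fun k : ℕ => (2 * k + 1 : ℝ) ^ (-(1 + u)) := by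
  have h := (summable_nat_rpow (p := -(1 + u))).2 (by linarith)
  have h2 := h.comp_injective (i := fun k : ℕ => 2 * k + 1) (fun a b hab => by simpa using hab)
  refine h2.congr fun k => ?_
  simp

lemma le_tsum_odd_rpow {u : ℝ} (hu : 0 < u) :
    2 + (3 : ℝ) ^ (-(1 + u)) + (3 : ℝ) ^ (-u) / u ≤ 2 * ∑' k : ℕ, (2 * k + 1 : ℝ) ^ (-(1 + u)) := by
  have h : ∀ n : ℕ, 2 + (3 : ℝ) ^ (-(1 + u)) + (3 : ℝ) ^ (-u) / u
      + (2 * n + 3 : ℝ) ^ (-(1 + u)) - (2 * n + 3 : ℝ) ^ (-u) / u ≤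
      2 * ∑ k ∈ range (n + 2), (2 * k + 1 : ℝ) ^ (-(1 + u)) := by
    intro n
    induction n with
    | zero =>
      simp only [sum_range_succ]
      norm_num
      linarith
    | succ n ih =>
      rw [sum_range_succ]
      have := rpow_neg_div_sub_le_trapezoid (x := 2 * n + 3) hu
        (by linarith [n.cast_nonneg (α := ℝ)])
      push_cast at ih ⊢
      have e : (2 * (n : ℝ) + 3 + 2) = 2 * (n + 2) + 1 := by ring
      have e' : 2 * ((n : ℝ) + 1) + 3 = 2 * (n + 2) + 1 := by ring
      rw [e] at this
      rw [e']
      linarith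
  have hlim : Filter.Tendsto (fun n : ℕ => 2 + (3 : ℝ) ^ (-(1 + u)) + (3 : ℝ) ^ (-u) / u
      - (2 * n + 3 : ℝ) ^ (-u) / u) Filter.atTop
      (nhds (2 + (3 : ℝ) ^ (-(1 + u)) + (3 : ℝ) ^ (-u) / u - 0 / u)) := by
    refine Filter.Tendsto.const_sub _ (Filter.Tendsto.div_const ?_ _)
    refine (tendsto_rpow_neg_atTop hu).comp ?_
    exact Filter.tendsto_atTop_add_const_right _ _
      (tendsto_natCast_atTop_atTop.const_mul_atTop (by norm_num))
  rw [zero_div, sub_zero] at hlim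
  refine le_of_tendsto' hlim fun n => ?_
  have hs := (summable_odd_rpow hu).sum_le_tsum (range (n + 2)) (fun k _ => by positivity)
  have : 0 ≤ (2 * n + 3 : ℝ) ^ (-(1 + u)) := by positivity
  linarith [h n]

lemma hasSum_odd_multiples {u : ℝ} (hu : 0 < u) {d : ℕ} (hd : Odd d) :
    HasSum (fun k : ℕ => if d ∣ 2 * k + 1 then (2 * k + 1 : ℝ) ^ (-(1 + u)) else 0)
      ((d : ℝ) ^ (-(1 + u)) * ∑' k : ℕ, (2 * k + 1 : ℝ) ^ (-(1 + u))) := by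
  obtain ⟨e, rfl⟩ := hd
  have hinj : Function.Injective fun k : ℕ => (2 * e + 1) * k + e := fun a b hab => by
    simpa using hab
  rw [← hinj.hasSum_iff]
  · convert! (summable_odd_rpow hu).hasSum.mul_left
      (((2 * e + 1 : ℕ) : ℝ) ^ (-(1 + u))) using 2 with k
    have hk : 2 * ((2 * e + 1) * k + e) + 1 = (2 * e + 1) * (2 * k + 1) := by ring
    simp only [Function.comp_apply]
    rw [hk, if_pos (dvd_mul_right _ _), ← mul_rpow (by positivity) (by positivity)]
    congr 1
    exact_mod_cast hk
  · intro k hk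
    rw [if_neg]
    rintro ⟨c, hc⟩
    have hco : Odd c := by
      have : Odd ((2 * e + 1) * c) := hc ▸ odd_two_mul_add_one k
      exact (Nat.odd_mul.1 this).2
    obtain ⟨j, rfl⟩ := hco
    exact hk ⟨j, by simp only; nlinarith⟩

open ArithmeticFunction hiding log in
lemma sum_vonMangoldt_mul_rpow_mul_le {u : ℝ} (hu : 0 < u) {T : Finset ℕ} (hT : ∀ d ∈ T, Odd d) :
    (∑ d ∈ T, vonMangoldt d * (d : ℝ) ^ (-(1 + u))) * ∑' k : ℕ, (2 * k + 1 : ℝ) ^ (-(1 + u)) ≤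
      ∑' k : ℕ, log (2 * k + 1 : ℝ) * (2 * k + 1 : ℝ) ^ (-(1 + u)) := by
  have h1 := hasSum_sum fun d hd => (hasSum_odd_multiples hu (hT d hd)).mul_left (vonMangoldt d)
  simp only [← mul_assoc] at h1
  rw [← sum_mul] at h1
  refine hasSum_le (fun k => ?_) h1 (summable_odd_log_mul_rpow hu).hasSum
  have hlog : log (2 * k + 1 : ℝ) = ∑ d ∈ (2 * k + 1).divisors, vonMangoldt d := by
    rw [vonMangoldt_sum]; push_cast; rfl
  simp only [mul_ite, mul_zero]
  rw [hlog, ← sum_filter, ← sum_mul]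
  refine mul_le_mul_of_nonneg_right ?_ (by positivity)
  refine sum_le_sum_of_subset_of_nonneg (fun d hd => ?_) fun _ _ _ => vonMangoldt_nonneg
  simp [(mem_filter.1 hd).2]

lemma log_le_of_pow_le_two_pow {p : ℝ} {j : ℕ} (hp : 0 < p) (h : p ^ 6 ≤ 2 ^ j) :
    log p ≤ j * 0.1155245302 := by
  have h1 := log_le_log (by positivity) h
  rw [log_pow, log_pow] at h1
  push_cast at h1
  nlinarith [log_two_lt_d9, j.cast_nonneg (α := ℝ)]

lemma sum_primes_Icc_two_mul_log_div_le :
    ∑ p ∈ (Icc 5 98).filter Nat.Prime, 2 * log p / (p * (p - 2) : ℝ) ≤ 0.525 := by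
  have hP : (Icc 5 98).filter Nat.Prime = {5, 7, 11, 13, 17, 19, 23, 29, 31, 37, 41, 43, 47, 53,
      59, 61, 67, 71, 73, 79, 83, 89, 97} := by
    ext p
    simp only [mem_filter, mem_Icc, mem_insert, mem_singleton]
    constructor
    · rintro ⟨⟨h1, h2⟩, hp⟩
      interval_cases p <;> first | (norm_num; done) | norm_num at hp
    · rintro h
      rcases h with (rfl | h)
      · norm_num
      repeat
        rcases h with (rfl | h)
        · norm_num
  have h5 := log_le_of_pow_le_two_pow (p := 5) (j := 14) (by norm_num) (by norm_num)
  have h7 := log_le_of_pow_le_two_pow (p := 7) (j := 17) (by norm_num) (by norm_num)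
  have h11 := log_le_of_pow_le_two_pow (p := 11) (j := 21) (by norm_num) (by norm_num)
  have h13 := log_le_of_pow_le_two_pow (p := 13) (j := 23) (by norm_num) (by norm_num)
  have h17 := log_le_of_pow_le_two_pow (p := 17) (j := 25) (by norm_num) (by norm_num)
  have h19 := log_le_of_pow_le_two_pow (p := 19) (j := 26) (by norm_num) (by norm_num)
  have h23 := log_le_of_pow_le_two_pow (p := 23) (j := 28) (by norm_num) (by norm_num)
  have h29 := log_le_of_pow_le_two_pow (p := 29) (j := 30) (by norm_num) (by norm_num)
  have h31 := log_le_of_pow_le_two_pow (p := 31) (j := 30) (by norm_num) (by norm_num)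
  have h37 := log_le_of_pow_le_two_pow (p := 37) (j := 32) (by norm_num) (by norm_num)
  have h41 := log_le_of_pow_le_two_pow (p := 41) (j := 33) (by norm_num) (by norm_num)
  have h43 := log_le_of_pow_le_two_pow (p := 43) (j := 33) (by norm_num) (by norm_num)
  have h47 := log_le_of_pow_le_two_pow (p := 47) (j := 34) (by norm_num) (by norm_num)
  have h53 := log_le_of_pow_le_two_pow (p := 53) (j := 35) (by norm_num) (by norm_num)
  have h59 := log_le_of_pow_le_two_pow (p := 59) (j := 36) (by norm_num) (by norm_num)
  have h61 := log_le_of_pow_le_two_pow (p := 61) (j := 36) (by norm_num) (by norm_num)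
  have h67 := log_le_of_pow_le_two_pow (p := 67) (j := 37) (by norm_num) (by norm_num)
  have h71 := log_le_of_pow_le_two_pow (p := 71) (j := 37) (by norm_num) (by norm_num)
  have h73 := log_le_of_pow_le_two_pow (p := 73) (j := 38) (by norm_num) (by norm_num)
  have h79 := log_le_of_pow_le_two_pow (p := 79) (j := 38) (by norm_num) (by norm_num)
  have h83 := log_le_of_pow_le_two_pow (p := 83) (j := 39) (by norm_num) (by norm_num)
  have h89 := log_le_of_pow_le_two_pow (p := 89) (j := 39) (by norm_num) (by norm_num)
  have h97 := log_le_of_pow_le_two_pow (p := 97) (j := 40) (by norm_num) (by norm_num)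
  rw [hP]
  norm_num [sum_insert] at *
  linarith

/-- Telescoping bound for the sum over odd integers. -/
lemma sum_odd_two_mul_log_div_le (n : ℕ) :
    ∑ k ∈ range n, 2 * log (2 * k + 99 : ℝ) / ((2 * k + 99) * (2 * k + 99 - 2)) ≤ 0.0631 := by
  have h : ∀ n : ℕ, ∑ k ∈ range n, 2 * log (2 * k + 99 : ℝ) / ((2 * k + 99) * (2 * k + 99 - 2)) ≤
      (log 97 + 99 / 97) / 97 - (log (2 * n + 97) + 99 / 97) / (2 * n + 97) := by
    intro n
    induction n with
    | zero => simp
    | succ n ih =>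
      rw [sum_range_succ]
      have hn := n.cast_nonneg (α := ℝ)
      set x : ℝ := 2 * n + 97 with hx
      have e : (2 * (n : ℝ) + 99) = x + 2 := by rw [hx]; ring
      have e' : 2 * ((n + 1 : ℕ) : ℝ) + 97 = x + 2 := by push_cast; rw [hx]; ring
      rw [e, e']
      have hx97 : 97 ≤ x := by linarith
      have hx0 : 0 < x := by linarith
      have hlog : log (x + 2) ≤ log x + 2 / x := by
        have h1 := log_le_sub_one_of_pos (div_pos (by linarith : 0 < x + 2) hx0)
        rw [log_div (by linarith) hx0.ne', add_div, div_self hx0.ne'] at h1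
        linarith
      have h2 : 2 / x * (x + 2) ≤ 2 * (99 / 97) := by
        rw [div_mul_eq_mul_div, div_le_iff₀ hx0]; linarith
      have h3 : 2 * log (x + 2) / ((x + 2) * (x + 2 - 2)) ≤
          (log x + 99 / 97) / x - (log (x + 2) + 99 / 97) / (x + 2) := by
        rw [div_sub_div _ _ hx0.ne' (by linarith), div_le_div_iff₀ (by nlinarith) (by nlinarith)]
        have h4 : 2 * log (x + 2) ≤
            (log x + 99 / 97) * (x + 2) - x * (log (x + 2) + 99 / 97) := by nlinarith
        have h5 : 0 < x * (x + 2) := by positivity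
        have := mul_le_mul_of_nonneg_right h4 h5.le
        linarith
      linarith
  refine (h n).trans ?_
  have h97 := log_le_of_pow_le_two_pow (p := 97) (j := 40) (by norm_num) (by norm_num)
  have h0 : 0 ≤ (log (2 * n + 97) + 99 / 97) / (2 * n + 97 : ℝ) := by
    have := log_nonneg (x := 2 * n + 97) (by linarith [n.cast_nonneg (α := ℝ)])
    positivity
  norm_num at h97
  linarith

lemma sum_primes_two_mul_log_div_le {P : Finset ℕ} (hP : ∀ p ∈ P, p.Prime ∧ 5 ≤ p) :
    ∑ p ∈ P, 2 * log p / (p * (p - 2) : ℝ) ≤ 0.589 := by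
  have hnn : ∀ p : ℕ, 5 ≤ p → 0 ≤ 2 * log p / (p * (p - 2) : ℝ) := by
    intro p hp
    have : (5 : ℝ) ≤ p := by exact_mod_cast hp
    have h1 := log_nonneg (x := (p : ℝ)) (by linarith)
    have h2 : 0 ≤ (p : ℝ) - 2 := by linarith
    positivity
  rw [← sum_filter_add_sum_filter_not P (· ≤ 98)]
  have h1 : ∑ p ∈ P.filter (· ≤ 98), 2 * log p / (p * (p - 2) : ℝ) ≤ 0.525 := by
    refine le_trans (sum_le_sum_of_subset_of_nonneg (fun p hp => ?_) fun p hp _ => ?_)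
      sum_primes_Icc_two_mul_log_div_le
    · simp only [mem_filter, mem_Icc] at hp ⊢
      exact ⟨⟨(hP p hp.1).2, hp.2⟩, (hP p hp.1).1⟩
    · exact hnn p (mem_Icc.1 (mem_filter.1 hp).1).1
  have h2 : ∑ p ∈ P.filter (¬ · ≤ 98), 2 * log p / (p * (p - 2) : ℝ) ≤ 0.0631 := by
    obtain ⟨n, hn⟩ := P.exists_nat_subset_range
    refine le_trans ?_ (sum_odd_two_mul_log_div_le n)
    have e : ∑ k ∈ range n, 2 * log (2 * k + 99 : ℝ) / ((2 * k + 99) * (2 * k + 99 - 2))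
        = ∑ p ∈ (range n).image (fun k : ℕ => (2 * k + 99 : ℕ)), 2 * log p / (p * (p - 2) : ℝ) := by
      rw [sum_image fun a _ b _ hab => by simpa using hab]
      push_cast
      rfl
    rw [e]
    refine sum_le_sum_of_subset_of_nonneg (fun p hp => ?_) fun p hp _ => ?_
    · simp only [mem_filter, mem_image, mem_range] at hp ⊢
      have h3 := mem_range.1 (hn hp.1)
      obtain ⟨k, hk⟩ := (hP p hp.1).1.odd_of_ne_two (by omega)
      exact ⟨k - 49, by omega, by omega⟩
    · obtain ⟨k, -, rfl⟩ := mem_image.1 hp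
      exact hnn _ (by omega)
  linarith

lemma cubic_bound {u q : ℝ} (hu : 0 < u) (hq : 1 + 1.0986 * u + 0.603 * u ^ 2 ≤ q) :
    (1.0987 + 2 / 3 * 1.0987 * u) * q ^ 2
      + ((2 / 3 * 1.0987 + 0.589) * q - 0.122) * (2 * u * q + (u / 3 + 1)) ≤
    (2 * q + 1 / 3) * q ^ 2 := by
  obtain ⟨d, rfl⟩ : ∃ d, q = 1 + 1.0986 * u + 0.603 * u ^ 2 + d := ⟨_, (add_sub_cancel _ _).symm⟩
  have hd : 0 ≤ d := by linarith
  have h : ∀ i j : ℕ, 0 ≤ u ^ i * d ^ j := fun i j => by positivity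
  linarith [sq_nonneg (u - 0.0626), h 2 0, h 3 0, h 4 0, h 5 0, h 6 0, h 0 1, h 1 1, h 2 1, h 3 1,
    h 4 1, h 0 2, h 1 2, h 2 2, h 0 3]

lemma three_rpow_neg_bound {u : ℝ} (hu : 0 < u) :
    log 3 + 2 / 3 * log 3 * u + (2 / 3 * log 3 + 0.589 - log 3 / 9 * (3 : ℝ) ^ (-u)) *
      (2 * u + (u / 3 + 1) * (3 : ℝ) ^ (-u)) ≤ 2 / (3 : ℝ) ^ (-u) + 1 / 3 := by
  have hl := log_three_gt_d9
  have hl' := log_three_lt_d9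
  have hinv : (3 : ℝ) ^ (-u) = ((3 : ℝ) ^ u)⁻¹ := rpow_neg (by norm_num) u
  rw [hinv]
  set q := (3 : ℝ) ^ u with hqdef
  have hq : 1 + 1.0986 * u + 0.603 * u ^ 2 ≤ q := by
    rw [hqdef, rpow_def_of_pos (by norm_num)]
    have h := quadratic_le_exp_of_nonneg (x := log 3 * u) (by positivity)
    have h2 : 1.206 ≤ log 3 ^ 2 := by nlinarith
    nlinarith [sq_nonneg u]
  have hq0 : 0 < q := by nlinarith [sq_nonneg u]
  have hq1 : 1 ≤ q := by nlinarith [sq_nonneg u]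
  have h := cubic_bound hu hq
  have hy : q⁻¹ ≤ 1 := inv_le_one_of_one_le₀ hq1
  have hy0 : 0 < q⁻¹ := inv_pos.2 hq0
  have h1 : (2 / 3 * log 3 + 0.589 - log 3 / 9 * q⁻¹) * (2 * u + (u / 3 + 1) * q⁻¹) ≤
      (2 / 3 * 1.0987 + 0.589 - 0.122 * q⁻¹) * (2 * u + (u / 3 + 1) * q⁻¹) := by
    apply mul_le_mul_of_nonneg_right _ (by positivity)
    nlinarith
  have h2 : (1.0987 + 2 / 3 * 1.0987 * u) +
      (2 / 3 * 1.0987 + 0.589 - 0.122 * q⁻¹) * (2 * u + (u / 3 + 1) * q⁻¹) ≤ 2 * q + 1 / 3 := by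
    refine le_of_mul_le_mul_right ?_ (pow_pos hq0 2)
    calc _ = _ := ?_
      _ ≤ _ := h
    field_simp
  have h3 : log 3 * u ≤ 1.0987 * u := by nlinarith
  rw [div_inv_eq_mul]
  linarith

open ArithmeticFunction hiding log in
lemma mul_sum_log_div_sub_two_mul_rpow_le_one {u : ℝ} (hu : 0 < u) {P : Finset ℕ}
    (hP : ∀ p ∈ P, p.Prime ∧ 3 ≤ p) :
    u * ∑ p ∈ P, log p / ((p : ℝ) - 2) * (p : ℝ) ^ (-u) ≤ 1 := by
  set D := ∑' k : ℕ, (2 * k + 1 : ℝ) ^ (-(1 + u)) with hD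
  set y := (3 : ℝ) ^ (-u) with hy
  have hy0 : 0 < y := by positivity
  have hl : 0 < log 3 := log_pos (by norm_num)
  have h3s : (3 : ℝ) ^ (-(1 + u)) = y / 3 := by
    rw [neg_add, add_comm, ← sub_eq_add_neg, rpow_sub_one (by norm_num)]
  have h9s : (9 : ℝ) ^ (-(1 + u)) = y ^ 2 / 9 := by
    rw [show (9 : ℝ) = 3 * 3 by norm_num, mul_rpow (by norm_num) (by norm_num), h3s]; ring
  have hDlow := le_tsum_odd_rpow hu
  have hNup := tsum_odd_log_mul_rpow_le hu
  have h9P : 9 ∉ P := fun h => absurd (hP 9 h).1 (by norm_num)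
  have hT : ∀ d ∈ insert 9 P, Odd d := by
    intro d hd
    rcases mem_insert.1 hd with rfl | hd
    · decide
    · exact (hP d hd).1.odd_of_ne_two (by have := (hP d hd).2; omega)
  have hmain := sum_vonMangoldt_mul_rpow_mul_le hu hT
  rw [sum_insert h9P] at hmain
  have hΛ9 : vonMangoldt 9 = log 3 := by
    rw [show 9 = 3 ^ 2 by norm_num, vonMangoldt_apply_pow (by norm_num),
      vonMangoldt_apply_prime Nat.prime_three]
    norm_num
  have hΛP : ∑ d ∈ P, vonMangoldt d * (d : ℝ) ^ (-(1 + u)) =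
      ∑ p ∈ P, log p * (p : ℝ) ^ (-(1 + u)) :=
    sum_congr rfl fun p hp => by rw [vonMangoldt_apply_prime (hP p hp).1]
  rw [hΛP, hΛ9, ← hD] at hmain
  push_cast at hmain
  rw [h9s] at hmain
  rw [← hD, ← hy, h3s] at hDlow
  rw [h3s, logRpowTail, ← hy] at hNup
  set A := ∑ p ∈ P, log p * (p : ℝ) ^ (-(1 + u)) with hA
  have hA0 : 0 ≤ A := sum_nonneg fun p _ => by positivity
  have hbound : (log 3 * (y ^ 2 / 9) + A) * (2 + y / 3 + y / u) ≤
      2 * (log 3 * (y / 3)) + y * (log 3 / u + 1 / u ^ 2) := by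
    have : (log 3 * (y ^ 2 / 9) + A) * (2 + y / 3 + y / u) ≤ (log 3 * (y ^ 2 / 9) + A) * (2 * D) :=
      mul_le_mul_of_nonneg_left hDlow (by positivity)
    linarith
  have hsplit : ∑ p ∈ P, log p / ((p : ℝ) - 2) * (p : ℝ) ^ (-u) ≤
      A + (2 / 3 * log 3 + 0.589) * y := by
    have hK : ∑ p ∈ P, 2 * log p / (p * (p - 2) : ℝ) ≤ 2 / 3 * log 3 + 0.589 := by
      rw [← sum_filter_add_sum_filter_not P (· = 3)]
      have h1 : ∑ p ∈ P.filter (· = 3), 2 * log p / (p * (p - 2) : ℝ) ≤ 2 / 3 * log 3 := by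
        rw [filter_eq']
        split_ifs
        · rw [sum_singleton]; push_cast; linarith
        · rw [sum_empty]; positivity
      have h2 := sum_primes_two_mul_log_div_le (P := P.filter (¬ · = 3)) fun p hp => by
        obtain ⟨hp, hp3⟩ := mem_filter.1 hp
        have h4 : p ≠ 4 := fun h => absurd (h ▸ (hP p hp).1) (by norm_num)
        have := (hP p hp).2
        exact ⟨(hP p hp).1, by omega⟩
      linarith
    refine le_trans ?_ (add_le_add_right (mul_le_mul_of_nonneg_right hK hy0.le) A)
    rw [hA, sum_mul, ← sum_add_distrib]
    refine sum_le_sum fun p hp => ?_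
    have hp3 : (3 : ℝ) ≤ p := by exact_mod_cast (hP p hp).2
    have hp0 : (0 : ℝ) < p := by linarith
    have hp2 : (0 : ℝ) < p - 2 := by linarith
    have hlp : 0 ≤ log p := log_nonneg (by linarith)
    have hps : (p : ℝ) ^ (-(1 + u)) = (p : ℝ) ^ (-u) / p := by
      rw [neg_add, add_comm, ← sub_eq_add_neg, rpow_sub_one hp0.ne']
    have hpy : (p : ℝ) ^ (-u) ≤ y := rpow_le_rpow_of_nonpos (by norm_num) hp3 (by linarith)
    have e : log p / ((p : ℝ) - 2) * (p : ℝ) ^ (-u) =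
        log p * (p : ℝ) ^ (-(1 + u)) + 2 * log p / (p * (p - 2)) * (p : ℝ) ^ (-u) := by
      rw [hps]; field_simp; ring
    rw [e]
    gcongr
  have hfin := three_rpow_neg_bound hu
  rw [← hy] at hfin
  refine (mul_le_mul_of_nonneg_left hsplit hu.le).trans ?_
  have hden : 0 < 2 + y / 3 + y / u := by positivity
  refine le_of_mul_le_mul_right ?_ (mul_pos hden hu)
  have e1 : (2 * (log 3 * (y / 3)) + y * (log 3 / u + 1 / u ^ 2)) * u ^ 2 =
      2 / 3 * log 3 * y * u ^ 2 + y * (log 3 * u + 1) := by field_simp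
  have e2 : (2 + y / 3 + y / u) * u = 2 * u + (u / 3 + 1) * y := by field_simp; ring
  have hb := mul_le_mul_of_nonneg_right hbound (sq_nonneg u)
  rw [e1] at hb
  have hf := mul_le_mul_of_nonneg_right hfin (mul_pos hy0 hu).le
  have e3 : (2 / y + 1 / 3) * (y * u) = 2 * u + y * u / 3 := by field_simp
  rw [e3] at hf
  rw [one_mul]
  have e4 : (log 3 * (y ^ 2 / 9) + A) * (2 + y / 3 + y / u) * u ^ 2 =
    (log 3 * (y ^ 2 / 9) + A) * (u * ((2 + y / 3 + y / u) * u)) := by ring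
  rw [e4] at hb
  rw [e2] at hb ⊢
  linarith

lemma integrableOn_mul_exp_neg_mul {r : ℝ} (hr : 0 < r) :
    MeasureTheory.IntegrableOn (fun u : ℝ => u * exp (-(r * u))) (Set.Ioi 0) := by
  have h := integrableOn_rpow_mul_exp_neg_mul_rpow (s := 1) (p := 1) (by norm_num) one_pos hr
  simpa using h

lemma integral_mul_exp_neg_mul {r : ℝ} (hr : 0 < r) :
    ∫ u in Set.Ioi (0 : ℝ), u * exp (-(r * u)) = 1 / r ^ 2 := by
  have h := integral_rpow_mul_exp_neg_mul_Ioi (a := 2) two_pos hr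
  norm_num at h
  simpa using h

lemma sum_log_div_sub_two_div_sq_le {v : ℝ} (hv : 0 < v) {P : Finset ℕ}
    (hP : ∀ p ∈ P, p.Prime ∧ 3 ≤ p) :
    ∑ p ∈ P, log p / ((p : ℝ) - 2) * (1 / (v + log p) ^ 2) ≤ 1 / v := by
  have hr : ∀ p ∈ P, 0 < v + log p := fun p hp => by
    have : (3 : ℝ) ≤ p := by exact_mod_cast (hP p hp).2
    linarith [log_nonneg (x := (p : ℝ)) (by linarith)]
  have hint : ∀ p ∈ P, MeasureTheory.IntegrableOn
      (fun u : ℝ => log p / ((p : ℝ) - 2) * (u * exp (-((v + log p) * u)))) (Set.Ioi 0) :=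
    fun p hp => (integrableOn_mul_exp_neg_mul (hr p hp)).const_mul _
  have e1 : ∑ p ∈ P, log p / ((p : ℝ) - 2) * (1 / (v + log p) ^ 2) =
      ∫ u in Set.Ioi (0 : ℝ), ∑ p ∈ P, log p / ((p : ℝ) - 2) * (u * exp (-((v + log p) * u))) := by
    rw [MeasureTheory.integral_finsetSum _ hint]
    refine sum_congr rfl fun p hp => ?_
    rw [MeasureTheory.integral_const_mul, integral_mul_exp_neg_mul (hr p hp)]
  have hexp : ∫ u in Set.Ioi (0 : ℝ), exp (-v * u) = 1 / v := by
    rw [integral_exp_mul_Ioi (by linarith) 0]; simp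
  rw [e1, ← hexp]
  refine MeasureTheory.setIntegral_mono_on (MeasureTheory.integrable_finsetSum _ hint)
    (integrableOn_exp_mul_Ioi (by linarith) 0) measurableSet_Ioi fun u hu => ?_
  have h := mul_le_mul_of_nonneg_left (mul_sum_log_div_sub_two_mul_rpow_le_one hu hP)
    (exp_pos (-v * u)).le
  rw [mul_one] at h
  refine le_of_eq_of_le ?_ h
  rw [mul_sum, mul_sum]
  refine sum_congr rfl fun p hp => ?_
  have hp0 : (0 : ℝ) < p := by exact_mod_cast (hP p hp).1.pos
  rw [rpow_def_of_pos hp0, show -((v + log p) * u) = -v * u + log p * -u by ring, exp_add]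
  ring

/-- The term of the sum at an odd prime `p` of exponent `a`, with `t = log p`. -/
lemma subinvariance_summand_le {L lam p a t : ℝ} (hL : 0 < L) (hle : L ≤ lam) (hp : 3 ≤ p) (ha : 0 ≤ a)
    (ht : 0 ≤ t) :
    L * (a + 1) * (p / (p - 2)) * t / (p * (L + t) * (lam + p / (p - 2) * t)) ≤
      L / 2 * (t / (p - 2) * (1 / (L + t) ^ 2) + t / (p - 2) * (1 / (lam + t) ^ 2))
        + a * t / (p - 2) / lam := by
  have hp0 : 0 < p := by linarith
  have hp2 : 0 < p - 2 := by linarith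
  have hlam : 0 < lam := by linarith
  have hβ : 1 ≤ p / (p - 2) := by rw [le_div_iff₀ hp2]; linarith
  set B := lam + p / (p - 2) * t with hB
  have hBt : lam + t ≤ B := by nlinarith
  have hB0 : 0 < B := by linarith
  have hw : 0 ≤ t / (p - 2) := by positivity
  have e : L * (a + 1) * (p / (p - 2)) * t / (p * (L + t) * B) =
      t / (p - 2) * (L * (1 / ((L + t) * B))) + a * t / (p - 2) * (L / ((L + t) * B)) := by
    field_simp
    ring
  have h1 : 1 / ((L + t) * B) ≤ (1 / (L + t) ^ 2 + 1 / (lam + t) ^ 2) / 2 := by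
    have h2 : 1 / ((L + t) * B) ≤ 1 / (L + t) * (1 / (lam + t)) := by
      rw [one_div_mul_one_div]
      gcongr
    have h3 := two_mul_le_add_sq (1 / (L + t)) (1 / (lam + t))
    simp only [one_div_pow] at h3
    linarith
  have h2 : L / ((L + t) * B) ≤ 1 / lam := by
    rw [div_le_div_iff₀ (by positivity) hlam]
    nlinarith
  have h3 := mul_le_mul_of_nonneg_left (mul_le_mul_of_nonneg_left h1 hL.le) hw
  have h4 := mul_le_mul_of_nonneg_left h2 (by positivity : 0 ≤ a * t / (p - 2))
  rw [e]
  rw [mul_one_div] at h4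
  linarith

theorem subinvariance_odd_banks_martin (m : ℕ) (hm : 1 < m)
    (hodd : ∀ p : ℕ, p.Prime → p ∣ m → p ≠ 2) (L lam : ℝ)
    (hL : L = Real.log m)
    (hlam : lam = ∑ p ∈ m.primeFactors,
        (m.factorization p : ℝ) * ((p : ℝ) / ((p : ℝ) - 2)) * Real.log p) :
    (∑' p : ℕ, if p.Prime ∧ 3 ≤ p then
        L * ((m.factorization p : ℝ) + 1) * ((p : ℝ) / ((p : ℝ) - 2)) * Real.log p /
          ((p : ℝ) * (L + Real.log p) * (lam + ((p : ℝ) / ((p : ℝ) - 2)) * Real.log p))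
      else 0) ≤ 1 := by
  have hprime : ∀ p ∈ m.primeFactors, p.Prime ∧ 3 ≤ p := fun p hp => by
    have h := Nat.prime_of_mem_primeFactors hp
    have h2 := hodd p h (Nat.dvd_of_mem_primeFactors hp)
    exact ⟨h, by have := h.two_le; omega⟩
  have hLpos : 0 < L := hL ▸ log_pos (by exact_mod_cast hm)
  have hw : ∀ p : ℕ, 3 ≤ p → 0 ≤ (m.factorization p : ℝ) * log p / ((p : ℝ) - 2) := fun p hp => by
    have h3 : (3 : ℝ) ≤ p := by exact_mod_cast hp
    have := log_nonneg (x := (p : ℝ)) (by linarith)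
    have h2 : 0 < (p : ℝ) - 2 := by linarith
    positivity
  have hdiff : ∑ p ∈ m.primeFactors, (m.factorization p : ℝ) * log p / ((p : ℝ) - 2) =
      (lam - L) / 2 := by
    have hLsum : L = ∑ p ∈ m.primeFactors, (m.factorization p : ℝ) * log p := by
      rw [hL, log_nat_eq_sum_factorization, Finsupp.sum, Nat.support_factorization]
    rw [hLsum, hlam, ← sum_sub_distrib, sum_div]
    refine sum_congr rfl fun p hp => ?_
    have h3 : (3 : ℝ) ≤ p := by exact_mod_cast (hprime p hp).2
    have h2 : (p : ℝ) - 2 ≠ 0 := by linarith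
    field_simp
    ring
  have hle : L ≤ lam := by
    have := sum_nonneg fun p hp => hw p (hprime p hp).2
    linarith
  have hlam0 : 0 < lam := by linarith
  have hterm : ∀ p : ℕ, 3 ≤ p → _ := fun p hp =>
    subinvariance_summand_le (p := p) (t := log p) hLpos hle (by exact_mod_cast hp)
      (m.factorization p).cast_nonneg (log_nonneg (by exact_mod_cast (by omega : 1 ≤ p)))
  refine tsum_le_of_sum_range_le (fun p => ?_) fun n => ?_
  · split_ifs with hp
    · have h3 : (3 : ℝ) ≤ p := by exact_mod_cast hp.2
      have := log_nonneg (x := (p : ℝ)) (by linarith)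
      have h2 : 0 < (p : ℝ) - 2 := by linarith
      positivity
    · exact le_rfl
  · rw [← sum_filter]
    have hP : ∀ p ∈ (range n).filter (fun p => p.Prime ∧ 3 ≤ p), p.Prime ∧ 3 ≤ p :=
      fun p hp => (mem_filter.1 hp).2
    generalize (range n).filter (fun p => p.Prime ∧ 3 ≤ p) = P at hP
    refine (sum_le_sum fun p hp => hterm p (hP p hp).2).trans ?_
    rw [sum_add_distrib, ← mul_sum, sum_add_distrib, ← sum_div]
    have hextra : ∑ p ∈ P, (m.factorization p : ℝ) * log p / ((p : ℝ) - 2) ≤ (lam - L) / 2 := by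
      rw [← hdiff, ← sum_filter_of_ne (p := (· ∈ m.primeFactors)) fun p _ hne => ?_]
      · exact sum_le_sum_of_subset_of_nonneg (fun p hp => (mem_filter.1 hp).2)
          fun p hp _ => hw p (hprime p hp).2
      · rw [← Nat.support_factorization, Finsupp.mem_support_iff]
        intro h0
        simp [h0] at hne
    have h1 := sum_log_div_sub_two_div_sq_le hLpos hP
    have h2 := sum_log_div_sub_two_div_sq_le hlam0 hP
    calc _ ≤ L / 2 * (1 / L + 1 / lam) + (lam - L) / 2 / lam := by gcongr
      _ = 1 := by field_simp; ring
end

section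
/- Define the von Mangoldt weight $\nu_{\Lambda} \colon \mathbb{N} \to (0,\infty)$ by $\nu_{\Lambda}(1) := 1$ and $\nu_{\Lambda}(n) := \int_1^\infty \frac{\log n}{\zeta(s)\, n^s}\, ds$ for $n > 1$, where $\zeta(s) = \sum_{k \geq 1} k^{-s}$ for real $s > 1$. Then $\nu_{\Lambda}$ is invariant for the von Mangoldt downward chain: for every natural number $n \geq 1$, $\sum_{q \geq 2} \nu_{\Lambda}(nq)\, \frac{\Lambda(q)}{\log(nq)} = \nu_{\Lambda}(n)$, where the sum is over natural numbers $q \geq 2$. -/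
/-- The Riemann zeta function on real `s > 1`, as the series `∑_{k ≥ 1} k^{-s}`. -/
noncomputable def zetaReal (s : ℝ) : ℝ := ∑' k : ℕ, 1 / ((k : ℝ) + 1) ^ s

/-- The von Mangoldt weight `ν_Λ`. -/
noncomputable def nuLambda (n : ℕ) : ℝ :=
  if n = 1 then 1
  else ∫ s in Set.Ioi (1 : ℝ), Real.log n / (zetaReal s * (n : ℝ) ^ s)

open ArithmeticFunction Filter MeasureTheory Set Topology

lemma ofReal_zetaReal {s : ℝ} (hs : 1 < s) : (zetaReal s : ℂ) = riemannZeta s := by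
  rw [zeta_eq_tsum_one_div_nat_add_one_cpow (by simpa using hs), zetaReal, Complex.ofReal_tsum]
  refine tsum_congr fun k => ?_
  rw [Complex.ofReal_div, Complex.ofReal_cpow (by positivity)]
  simp

lemma summable_one_div_nat_add_one_rpow {s : ℝ} :
    Summable (fun k : ℕ => 1 / ((k : ℝ) + 1) ^ s) ↔ 1 < s := by
  rw [← Real.summable_one_div_nat_rpow,
    ← summable_nat_add_iff (f := fun k : ℕ => 1 / (k : ℝ) ^ s) 1]
  simp

lemma one_le_zetaReal {s : ℝ} (hs : 1 < s) : 1 ≤ zetaReal s := by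
  have h := (summable_one_div_nat_add_one_rpow.2 hs).le_tsum 0 (fun j _ => by positivity)
  simpa [zetaReal] using h

lemma zetaReal_pos {s : ℝ} (hs : 1 < s) : 0 < zetaReal s :=
  zero_lt_one.trans_le (one_le_zetaReal hs)

lemma zetaReal_one : zetaReal 1 = 0 :=
  tsum_eq_zero_of_not_summable fun h => lt_irrefl _ (summable_one_div_nat_add_one_rpow.1 h)

lemma tendsto_zetaReal_atTop : Tendsto zetaReal atTop (𝓝 1) := by
  have h := LSeries.tendsto_atTop (f := 1)
    (by rw [LSeries.abscissaOfAbsConv_one]; exact EReal.coe_lt_top 1)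
  rw [← tendsto_ofReal_iff, Complex.ofReal_one]
  refine h.congr' ?_
  filter_upwards [Ioi_mem_atTop 1] with s hs
  rw [ofReal_zetaReal hs, LSeries_one_eq_riemannZeta (by simpa using hs)]

lemma tendsto_inv_zetaReal_one : Tendsto (fun s => (zetaReal s)⁻¹) (𝓝[>] 1) (𝓝 0) := by
  have h : Tendsto (fun s : ℝ => (s - 1) * zetaReal s) (𝓝[>] 1) (𝓝 1) := by
    refine tendsto_sub_mul_tsum_nat_rpow.congr' ?_
    filter_upwards [self_mem_nhdsWithin] with s hs
    have hs : 1 < s := hs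
    rw [(Real.summable_one_div_nat_rpow.2 hs).tsum_eq_zero_add]
    simp [zetaReal, Real.zero_rpow (by linarith : s ≠ 0)]
  have h1 : Tendsto (fun s : ℝ => s - 1) (𝓝[>] 1) (𝓝 0) := by
    have : Tendsto (fun s : ℝ => s - 1) (𝓝 1) (𝓝 (1 - 1)) := by
      exact (continuous_id.sub continuous_const).tendsto 1
    rw [sub_self] at this
    exact this.mono_left nhdsWithin_le_nhds
  have h2 := h1.mul (h.inv₀ one_ne_zero)
  rw [zero_mul] at h2
  refine h2.congr' ?_
  filter_upwards [self_mem_nhdsWithin] with s hs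
  have hs : 1 < s := hs
  have : s - 1 ≠ 0 := by linarith
  have := (zetaReal_pos hs).ne'
  field_simp

lemma ofReal_vonMangoldt_div_rpow (s : ℝ) (q : ℕ) :
    ((Λ q / (q : ℝ) ^ s : ℝ) : ℂ) = LSeries.term (fun n => (Λ n : ℂ)) s q := by
  rw [LSeries.term_def, Complex.ofReal_div, Complex.ofReal_cpow (by positivity)]
  split_ifs with h
  · simp [h]
  · simp

lemma hasSum_vonMangoldt_div_rpow {s : ℝ} (hs : 1 < s) :
    HasSum (fun q : ℕ => Λ q / (q : ℝ) ^ s) (∑' q : ℕ, Λ q / (q : ℝ) ^ s) := by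
  refine Summable.hasSum ?_
  rw [← Complex.summable_ofReal]
  simp_rw [ofReal_vonMangoldt_div_rpow]
  exact LSeriesSummable_vonMangoldt (by simpa using hs)

lemma hasDerivAt_zetaReal {s : ℝ} (hs : 1 < s) :
    HasDerivAt zetaReal (-(zetaReal s * ∑' q : ℕ, Λ q / (q : ℝ) ^ s)) s := by
  have hs' : 1 < (s : ℂ).re := by simpa using hs
  have hd := (differentiableAt_riemannZeta (s := (s : ℂ))
    (by exact_mod_cast hs.ne')).hasDerivAt.real_of_complex
  have hL := LSeries_vonMangoldt_eq_deriv_riemannZeta_div hs'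
  have hL' : LSeries (fun n => (Λ n : ℂ)) s = ((∑' q : ℕ, Λ q / (q : ℝ) ^ s : ℝ) : ℂ) := by
    rw [LSeries, Complex.ofReal_tsum]
    simp_rw [ofReal_vonMangoldt_div_rpow]
  rw [hL', ← ofReal_zetaReal hs, eq_div_iff (by exact_mod_cast (zetaReal_pos hs).ne')] at hL
  have he : deriv riemannZeta s
      = ((-(zetaReal s * ∑' q : ℕ, Λ q / (q : ℝ) ^ s) : ℝ) : ℂ) := by
    rw [Complex.ofReal_neg, Complex.ofReal_mul, mul_comm, hL, neg_neg]
  rw [he, Complex.ofReal_re] at hd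
  refine hd.congr_of_eventuallyEq ?_
  filter_upwards [Ioi_mem_nhds hs] with t ht
  rw [← ofReal_zetaReal ht, Complex.ofReal_re]

lemma hasDerivAt_inv_zetaReal {s : ℝ} (hs : 1 < s) :
    HasDerivAt (fun t => (zetaReal t)⁻¹)
      ((zetaReal s)⁻¹ * ∑' q : ℕ, Λ q / (q : ℝ) ^ s) s := by
  have hz := (zetaReal_pos hs).ne'
  refine ((hasDerivAt_zetaReal hs).inv hz).congr_deriv ?_
  field_simp

lemma continuousWithinAt_inv_zetaReal_one :
    ContinuousWithinAt (fun s => (zetaReal s)⁻¹) (Ici 1) 1 := by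
  rw [← continuousWithinAt_Ioi_iff_Ici, ContinuousWithinAt, zetaReal_one, inv_zero]
  exact tendsto_inv_zetaReal_one

lemma tsum_vonMangoldt_div_rpow_nonneg (s : ℝ) : 0 ≤ ∑' q : ℕ, Λ q / (q : ℝ) ^ s :=
  tsum_nonneg fun _ => div_nonneg vonMangoldt_nonneg (by positivity)

lemma tendsto_inv_zetaReal_atTop : Tendsto (fun s => (zetaReal s)⁻¹) atTop (𝓝 1) := by
  simpa using tendsto_zetaReal_atTop.inv₀ one_ne_zero

lemma integrableOn_deriv_inv_zetaReal :
    IntegrableOn (fun s => (zetaReal s)⁻¹ * ∑' q : ℕ, Λ q / (q : ℝ) ^ s) (Ioi 1) :=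
  integrableOn_Ioi_deriv_of_nonneg continuousWithinAt_inv_zetaReal_one
    (fun _ hx => hasDerivAt_inv_zetaReal hx)
    (fun _ hx => mul_nonneg (inv_nonneg.2 (zetaReal_pos hx).le)
      (tsum_vonMangoldt_div_rpow_nonneg _))
    tendsto_inv_zetaReal_atTop

lemma continuousOn_zetaReal : ContinuousOn zetaReal (Ioi 1) := fun _ hx =>
  (hasDerivAt_zetaReal hx).continuousAt.continuousWithinAt

lemma continuous_natCast_rpow {n : ℕ} (hn : 1 ≤ n) : Continuous fun s : ℝ => (n : ℝ) ^ s :=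
  Real.continuous_const_rpow (by positivity)

lemma integrableOn_rpow_mul_deriv_inv_zetaReal {n : ℕ} (hn : 1 ≤ n) :
    IntegrableOn (fun s => ((n : ℝ) ^ s)⁻¹ * ((zetaReal s)⁻¹ * ∑' q : ℕ, Λ q / (q : ℝ) ^ s))
      (Ioi 1) := by
  have hn1 : (1 : ℝ) ≤ n := by exact_mod_cast hn
  refine Integrable.bdd_mul (c := 1) integrableOn_deriv_inv_zetaReal ?_ ?_
  · exact ((continuous_natCast_rpow hn).inv₀ fun s => by positivity).aestronglyMeasurable
  · filter_upwards [ae_restrict_mem measurableSet_Ioi] with s hs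
    have hs : 1 < s := hs
    rw [Real.norm_of_nonneg (by positivity)]
    exact inv_le_one_of_one_le₀ (Real.one_le_rpow hn1 (by linarith))

lemma integrableOn_log_div {n : ℕ} (hn : 1 ≤ n) :
    IntegrableOn (fun s => Real.log n / (zetaReal s * (n : ℝ) ^ s)) (Ioi 1) := by
  rcases hn.eq_or_lt with rfl | hn2
  · simp
  have hn0 : (0 : ℝ) < n := by positivity
  have hlog : 0 < Real.log n := Real.log_pos (by exact_mod_cast hn2)
  have hexp : IntegrableOn (fun s => Real.log n * Real.exp (-Real.log n * s)) (Ioi 1) :=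
    (exp_neg_integrableOn_Ioi 1 hlog).const_mul _
  refine Integrable.mono' hexp ?_ ?_
  · refine ContinuousOn.aestronglyMeasurable ?_ measurableSet_Ioi
    refine continuousOn_const.div
      (continuousOn_zetaReal.mul (continuous_natCast_rpow hn).continuousOn) fun s hs => ?_
    have := zetaReal_pos hs
    positivity
  · filter_upwards [ae_restrict_mem measurableSet_Ioi] with s hs
    have hz := one_le_zetaReal hs
    have hz0 := zetaReal_pos hs
    have hp : 0 < (n : ℝ) ^ s := by positivity
    rw [Real.norm_of_nonneg (by positivity), neg_mul, Real.exp_neg, ← Real.rpow_def_of_pos hn0,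
      ← div_eq_mul_inv]
    gcongr
    exact le_mul_of_one_le_left hp.le hz

lemma integral_rpow_mul_deriv_inv_zetaReal {n : ℕ} (hn : 1 ≤ n) :
    ∫ s in Ioi (1 : ℝ),
      ((n : ℝ) ^ s)⁻¹ * ((zetaReal s)⁻¹ * ∑' q : ℕ, Λ q / (q : ℝ) ^ s) = nuLambda n := by
  rcases hn.eq_or_lt with rfl | hn2
  · have h := integral_Ioi_of_hasDerivAt_of_tendsto continuousWithinAt_inv_zetaReal_one
      (fun _ hx => hasDerivAt_inv_zetaReal hx) integrableOn_deriv_inv_zetaReal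
      tendsto_inv_zetaReal_atTop
    simpa [nuLambda, zetaReal_one] using h
  have hn0 : (0 : ℝ) < n := by positivity
  have hn1 : (1 : ℝ) < n := by exact_mod_cast hn2
  have hA := integrableOn_rpow_mul_deriv_inv_zetaReal hn
  have hB := integrableOn_log_div hn
  have hpow : ∀ s : ℝ, HasDerivAt (fun t : ℝ => ((n : ℝ) ^ t)⁻¹)
      (-(Real.log n * ((n : ℝ) ^ s)⁻¹)) s := fun s => by
    have hp : (n : ℝ) ^ s ≠ 0 := by positivity
    refine ((Real.hasStrictDerivAt_const_rpow hn0 s).hasDerivAt.inv hp).congr_deriv ?_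
    field_simp
  have hcont : ContinuousWithinAt (fun s => ((n : ℝ) ^ s)⁻¹ * (zetaReal s)⁻¹) (Ici 1) 1 :=
    (hpow 1).continuousAt.continuousWithinAt.mul continuousWithinAt_inv_zetaReal_one
  have hlim : Tendsto (fun s : ℝ => ((n : ℝ) ^ s)⁻¹ * (zetaReal s)⁻¹) atTop (𝓝 0) := by
    have h := (tendsto_rpow_atTop_of_base_gt_one n hn1).inv_tendsto_atTop.mul
      tendsto_inv_zetaReal_atTop
    simpa using h
  have h := integral_Ioi_of_hasDerivAt_of_tendsto hcont (f' := fun s =>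
      ((n : ℝ) ^ s)⁻¹ * ((zetaReal s)⁻¹ * ∑' q : ℕ, Λ q / (q : ℝ) ^ s)
        - Real.log n / (zetaReal s * (n : ℝ) ^ s)) (fun s hs => by
      refine ((hpow s).mul (hasDerivAt_inv_zetaReal hs)).congr_deriv ?_
      have := (zetaReal_pos hs).ne'
      field_simp
      ring) (hA.sub hB) hlim
  rw [integral_sub hA hB, zetaReal_one, inv_zero, mul_zero, sub_zero, sub_eq_zero] at h
  rw [h, nuLambda, if_neg hn2.ne']

lemma hasSum_integral_vonMangoldt {n : ℕ} (hn : 1 ≤ n) :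
    HasSum (fun q : ℕ => ∫ s in Ioi (1 : ℝ),
      ((n : ℝ) ^ s)⁻¹ * ((zetaReal s)⁻¹ * (Λ q / (q : ℝ) ^ s))) (nuLambda n) := by
  rw [← integral_rpow_mul_deriv_inv_zetaReal hn]
  have hsum : ∀ᵐ s ∂(volume.restrict (Ioi (1 : ℝ))),
      HasSum (fun q : ℕ => ((n : ℝ) ^ s)⁻¹ * ((zetaReal s)⁻¹ * (Λ q / (q : ℝ) ^ s)))
        (((n : ℝ) ^ s)⁻¹ * ((zetaReal s)⁻¹ * ∑' q : ℕ, Λ q / (q : ℝ) ^ s)) := by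
    filter_upwards [ae_restrict_mem measurableSet_Ioi] with s hs
    exact ((hasSum_vonMangoldt_div_rpow hs).mul_left _).mul_left _
  refine hasSum_integral_of_dominated_convergence
    (fun q s => ((n : ℝ) ^ s)⁻¹ * ((zetaReal s)⁻¹ * (Λ q / (q : ℝ) ^ s)))
    (fun q => ?_) (fun q => ?_) (hsum.mono fun _ h => h.summable) ?_ hsum
  · rcases Nat.eq_zero_or_pos q with rfl | hq
    · simpa using aestronglyMeasurable_const
    refine ContinuousOn.aestronglyMeasurable ?_ measurableSet_Ioi
    refine ((continuous_natCast_rpow hn).inv₀ fun s => by positivity).continuousOn.mul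
      ((continuousOn_zetaReal.inv₀ fun s hs => (zetaReal_pos hs).ne').mul
        (continuous_const.div (continuous_natCast_rpow hq) fun s => by positivity).continuousOn)
  · filter_upwards [ae_restrict_mem measurableSet_Ioi] with s hs
    have := zetaReal_pos hs
    have := vonMangoldt_nonneg (n := q)
    exact (Real.norm_of_nonneg (by positivity)).le
  · exact (integrableOn_rpow_mul_deriv_inv_zetaReal hn).congr
      (hsum.mono fun _ h => h.tsum_eq.symm)

theorem nuLambda_invariant (n : ℕ) (hn : 1 ≤ n) :
    (∑' q : ℕ, if 2 ≤ q then
        nuLambda (n * q) * (ArithmeticFunction.vonMangoldt q / Real.log ((n : ℝ) * q))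
      else 0) = nuLambda n := by
  rw [← (hasSum_integral_vonMangoldt hn).tsum_eq]
  refine tsum_congr fun q => ?_
  split_ifs with hq
  · have hnq : 1 < n * q := by nlinarith
    have hlog : Real.log ((n : ℝ) * q) ≠ 0 := (Real.log_pos (by exact_mod_cast hnq)).ne'
    rw [nuLambda, if_neg hnq.ne', ← integral_mul_const]
    refine setIntegral_congr_fun measurableSet_Ioi fun s hs => ?_
    have hz := (zetaReal_pos hs).ne'
    have hn0 : (n : ℝ) ^ s ≠ 0 := by positivity
    have hq0 : (q : ℝ) ^ s ≠ 0 := by positivity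
    simp only [Nat.cast_mul]
    rw [Real.mul_rpow (by positivity) (by positivity)]
    field_simp
  · have : q = 0 ∨ q = 1 := by omega
    rcases this with rfl | rfl <;> simp
end

section
/- There is an absolute constant $C$ such that for every primitive set $A$ of natural numbers not containing $1$, every real $x \geq 2$, and every divisor-closed set $\mathcal{D} \subseteq \mathbb{N}$, one has $\sum_{n \in A \cap \mathcal{D},\ n \geq x} \frac{1}{n \log n} \leq \left(1 + \frac{C}{\log x}\right) \frac{1}{\log x} \sum_{n \in \mathcal{D},\ n \leq x} \frac{1}{n}$. -/
/-- A set of natural numbers is primitive if no element divides another distinct element. -/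
def Primitive (A : Set ℕ) : Prop := ∀ a ∈ A, ∀ b ∈ A, a ≠ b → ¬ a ∣ b

open Finset ArithmeticFunction in
theorem log_factorial_eq_sum_vonMangoldt (n : ℕ) :
    Real.log (n.factorial) = ∑ d ∈ Ioc 0 n, vonMangoldt d * ((n / d : ℕ) : ℝ) := by
  rw [← sum_Ioc_mul_zeta_eq_sum, vonMangoldt_mul_zeta]
  induction n with
  | zero => simp
  | succ k ih =>
    rw [← Order.succ_eq_add_one, ← insert_Ioc_right_eq_Ioc_succ (by omega), sum_insert (by simp),
      ← ih, Order.succ_eq_add_one, Nat.factorial_succ, Nat.cast_mul,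
      Real.log_mul (by positivity) (by positivity), log_apply]

open Finset ArithmeticFunction in
theorem sum_vonMangoldt_div_le (n : ℕ) (hn : 0 < n) :
    ∑ d ∈ Ioc 0 n, vonMangoldt d / (d : ℝ) ≤ Real.log n + (Real.log 4 + 4) := by
  have hn' : (0 : ℝ) < n := by exact_mod_cast hn
  have h1 : Real.log (n.factorial) ≤ n * Real.log n := by
    rw [← Real.log_pow]
    exact Real.log_le_log (by positivity) (by exact_mod_cast Nat.factorial_le_pow n)
  have h2 : ∑ d ∈ Ioc 0 n, vonMangoldt d ≤ (Real.log 4 + 4) * n := by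
    simpa [Chebyshev.psi] using Chebyshev.psi_le_const_mul_self hn'.le
  have h3 : ∑ d ∈ Ioc 0 n, vonMangoldt d * ((n : ℝ) / d) ≤
      Real.log (n.factorial) + ∑ d ∈ Ioc 0 n, vonMangoldt d := by
    rw [log_factorial_eq_sum_vonMangoldt, ← sum_add_distrib]
    refine sum_le_sum fun d hd => ?_
    have hd0 : 0 < d := (mem_Ioc.1 hd).1
    have : (n : ℝ) / d ≤ ((n / d : ℕ) : ℝ) + 1 := by
      rw [div_le_iff₀ (by exact_mod_cast hd0)]
      exact_mod_cast (Nat.lt_mul_of_div_lt (Nat.lt_succ_self (n / d)) hd0).le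
    nlinarith [vonMangoldt_nonneg (n := d)]
  have h4 : ∑ d ∈ Ioc 0 n, vonMangoldt d * ((n : ℝ) / d) =
      n * ∑ d ∈ Ioc 0 n, vonMangoldt d / (d : ℝ) := by
    rw [mul_sum]
    exact sum_congr rfl fun d _ => by ring
  rw [h4] at h3
  refine le_of_mul_le_mul_left ?_ hn'
  linarith

open Finset ArithmeticFunction in
theorem le_sum_vonMangoldt_div (n : ℕ) :
    Real.log (n + 1) - 2 ≤ ∑ d ∈ Ioc 0 n, vonMangoldt d / (d : ℝ) := by
  rcases Nat.eq_zero_or_pos n with rfl | hn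
  · simp
  have hn' : (1 : ℝ) ≤ n := by exact_mod_cast hn
  have h1 : n * Real.log n - n ≤ Real.log (n.factorial) := by
    have := Stirling.le_log_factorial_stirling hn.ne'
    have h2 : 0 ≤ Real.log n := Real.log_nonneg hn'
    have h3 : 0 ≤ Real.log (2 * Real.pi) := Real.log_nonneg (by linarith [Real.pi_gt_three])
    linarith
  have h2 : Real.log (n.factorial) ≤ n * ∑ d ∈ Ioc 0 n, vonMangoldt d / (d : ℝ) := by
    rw [log_factorial_eq_sum_vonMangoldt, mul_sum]
    refine sum_le_sum fun d _ => ?_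
    calc vonMangoldt d * ((n / d : ℕ) : ℝ) ≤ vonMangoldt d * ((n : ℝ) / d) :=
          mul_le_mul_of_nonneg_left Nat.cast_div_le vonMangoldt_nonneg
      _ = _ := by ring
  have h3 : Real.log n - 1 ≤ ∑ d ∈ Ioc 0 n, vonMangoldt d / (d : ℝ) := by
    refine le_of_mul_le_mul_left ?_ (by linarith : (0 : ℝ) < n)
    linarith
  have h4 : Real.log (n + 1) ≤ Real.log n + 1 := by
    have : Real.log (n + 1) ≤ Real.log (2 * n) := Real.log_le_log (by linarith) (by linarith)
    rw [Real.log_mul (by norm_num) (by linarith)] at this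
    linarith [Real.log_two_lt_d9]
  linarith

open Finset ArithmeticFunction in
/-- Mertens' estimate for `∑ Λ(q) / q` over an interval, in the form of an upper bound. -/
theorem exists_sum_Icc_vonMangoldt_div_le :
    ∃ K : ℝ, 0 < K ∧ ∀ y : ℝ, 1 ≤ y → ∀ k : ℕ, ⌈y⌉₊ ≤ k →
      ∑ q ∈ Icc ⌈y⌉₊ k, vonMangoldt q / (q : ℝ) ≤ Real.log k - Real.log y + K := by
  refine ⟨Real.log 4 + 4 + 2, by positivity, fun y hy k hk => ?_⟩
  have hc : 0 < ⌈y⌉₊ := Nat.ceil_pos.2 (by linarith)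
  obtain ⟨n, hn⟩ : ∃ n, ⌈y⌉₊ = n + 1 := ⟨⌈y⌉₊ - 1, by omega⟩
  have hyn : y ≤ n + 1 := by
    have := Nat.le_ceil y
    rw [hn] at this
    exact_mod_cast this
  rw [hn] at hk ⊢
  have h1 := sum_vonMangoldt_div_le k (by omega)
  have h2 := le_sum_vonMangoldt_div n
  have h3 : Real.log y ≤ Real.log (n + 1) := Real.log_le_log (by linarith) hyn
  have h4 := sum_Ioc_consecutive (fun q : ℕ => vonMangoldt q / (q : ℝ)) (Nat.zero_le n)
    (by omega : n ≤ k)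
  rw [show Icc (n + 1) k = Ioc n k by ext; simp]
  linarith

open Finset in
/-- Partial summation against the weight `1 / r ^ 2`, where `r k = log k + c`. -/
theorem sum_Icc_mul_inv_sq_le {a : ℕ → ℝ} {c s K : ℝ} {b : ℕ} (hb : 0 < b) (hs : 0 < s)
    (hK : 0 ≤ K) (hsb : s ≤ Real.log b + c)
    (ha : ∀ k, b ≤ k → ∑ q ∈ Icc b k, a q ≤ Real.log k + c - s + K) (N : ℕ) (hN : b ≤ N) :
    ∑ q ∈ Icc b N, a q * (1 / (Real.log q + c) ^ 2) ≤ K / s ^ 2 + 1 / s := by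
  have hr : ∀ k, b ≤ k → s ≤ Real.log k + c := fun k hk => by
    have : Real.log b ≤ Real.log k :=
      Real.log_le_log (by exact_mod_cast hb) (by exact_mod_cast hk)
    linarith
  have key : ∀ p r : ℝ, 0 < p → p ≤ r → (r - p) * (1 / r ^ 2) ≤ 1 / p - 1 / r := by
    intro p r hp hpr
    have hr : 0 < r := by linarith
    rw [div_sub_div _ _ hp.ne' hr.ne', mul_one_div, div_le_div_iff₀ (by positivity) (by positivity)]
    have : 0 ≤ (r - p) * r * (r - p) := by
      have : 0 ≤ r - p := by linarith
      positivity
    nlinarith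
  have main : ∑ q ∈ Icc b N, a q * (1 / (Real.log q + c) ^ 2) ≤
      (∑ q ∈ Icc b N, a q - (Real.log N + c - s + K)) * (1 / (Real.log N + c) ^ 2) +
        K / s ^ 2 + 1 / s - 1 / (Real.log N + c) := by
    induction N, hN using Nat.le_induction with
    | base =>
      simp only [Icc_self, sum_singleton]
      have h1 := key s _ hs hsb
      have h2 : K * (1 / (Real.log b + c) ^ 2) ≤ K / s ^ 2 := by
        rw [mul_one_div]
        gcongr
      linarith
    | succ k hk ih =>
      rw [sum_Icc_succ_top (by omega), sum_Icc_succ_top (by omega)]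
      have hk0 : (0 : ℝ) < k := by exact_mod_cast (by omega : 0 < k)
      have hrk := hr k hk
      have hle : Real.log k + c ≤ Real.log ((k + 1 : ℕ) : ℝ) + c := by
        have : Real.log k ≤ Real.log ((k + 1 : ℕ) : ℝ) :=
          Real.log_le_log hk0 (by push_cast; linarith)
        linarith
      have h1 := key _ _ (by linarith) hle
      have h2 : 1 / (Real.log ((k + 1 : ℕ) : ℝ) + c) ^ 2 ≤ 1 / (Real.log k + c) ^ 2 := by
        have : 0 < Real.log k + c := by linarith
        gcongr
      have h3 := mul_le_mul_of_nonpos_left h2 (by linarith [ha k hk] :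
        ∑ q ∈ Icc b k, a q - (Real.log k + c - s + K) ≤ 0)
      linarith
  have h1 : (∑ q ∈ Icc b N, a q - (Real.log N + c - s + K)) * (1 / (Real.log N + c) ^ 2) ≤ 0 :=
    mul_nonpos_of_nonpos_of_nonneg (by linarith [ha N hN]) (by positivity)
  have h2 : 0 ≤ 1 / (Real.log N + c) := by
    have := hr N hN
    have : 0 < Real.log N + c := by linarith
    positivity
  linarith

open Finset ArithmeticFunction in
theorem sum_vonMangoldt_mul_weight_le {K : ℝ} (hK0 : 0 < K)
    (hK : ∀ y : ℝ, 1 ≤ y → ∀ k : ℕ, ⌈y⌉₊ ≤ k →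
      ∑ q ∈ Icc ⌈y⌉₊ k, vonMangoldt q / (q : ℝ) ≤ Real.log k - Real.log y + K)
    {m : ℕ} (hm : 0 < m) {x : ℝ} (hmx : (m : ℝ) ≤ x) (hx : K < Real.log x) (N : ℕ) :
    ∑ q ∈ Ioc 0 N with x ≤ ((m * q : ℕ) : ℝ),
        vonMangoldt q * (1 / ((Real.log ((m * q : ℕ) : ℝ) - K) ^ 2 * ((m * q : ℕ) : ℝ))) ≤
      Real.log x / (Real.log x - K) ^ 2 * (1 / (m : ℝ)) := by
  have hm' : (0 : ℝ) < m := by exact_mod_cast hm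
  have hx0 : 0 < x := by linarith
  have hy : 1 ≤ x / m := by rwa [one_le_div hm']
  have hc : 0 < ⌈x / m⌉₊ := Nat.ceil_pos.2 (by linarith)
  have hset : (Ioc 0 N).filter (fun q : ℕ => x ≤ ((m * q : ℕ) : ℝ)) = Icc ⌈x / m⌉₊ N := by
    ext q
    simp only [mem_filter, mem_Ioc, mem_Icc, Nat.ceil_le, div_le_iff₀ hm']
    push_cast
    rw [mul_comm (q : ℝ)]
    constructor
    · tauto
    · rintro ⟨h1, h2⟩
      refine ⟨⟨?_, h2⟩, h1⟩
      rcases Nat.eq_zero_or_pos q with rfl | h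
      · simp at h1
        linarith
      · exact h
  rw [hset]
  have hs : 0 < Real.log x - K := by linarith
  have hlog : Real.log (x / m) = Real.log x - Real.log m := Real.log_div hx0.ne' hm'.ne'
  rcases lt_or_ge N ⌈x / m⌉₊ with hN | hN
  · rw [Icc_eq_empty (by omega), sum_empty]
    have : 0 < Real.log x := by linarith
    positivity
  have h := sum_Icc_mul_inv_sq_le (a := fun q => vonMangoldt q / (q : ℝ)) (c := Real.log m - K)
    (s := Real.log x - K) (K := K) hc hs hK0.le
    (by
      have : Real.log (x / m) ≤ Real.log ⌈x / m⌉₊ :=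
        Real.log_le_log (by linarith) (Nat.le_ceil _)
      linarith)
    (fun k hk => by linarith [hK _ hy k hk]) N hN
  have e : K / (Real.log x - K) ^ 2 + 1 / (Real.log x - K) =
      Real.log x / (Real.log x - K) ^ 2 := by
    field_simp
    ring
  rw [e] at h
  refine le_trans (le_of_eq ?_) (mul_le_mul_of_nonneg_right h (by positivity))
  rw [sum_mul]
  refine sum_congr rfl fun q hq => ?_
  have hq0 : (0 : ℝ) < q := by
    have := (mem_Icc.1 hq).1
    exact_mod_cast (by omega : 0 < q)
  rw [Nat.cast_mul, Real.log_mul hm'.ne' hq0.ne',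
    show Real.log q + (Real.log m - K) = Real.log m + Real.log q - K by ring]
  simp only [div_eq_mul_inv, mul_inv, one_mul]
  ring

open Finset ArithmeticFunction in
open scoped Classical in
/-- A flow of mass along the edges `m → m * q`, of size `Λ q * w (m * q)`, that loses mass at every
vertex `m ≥ x` crosses a primitive set at most once: the total mass on such a set is at most the
inflow through the edges which cross `x`. -/
theorem sum_primitive_le_inflow {D : Set ℕ} (hD : ∀ n ∈ D, ∀ m : ℕ, m ∣ n → m ∈ D)
    {x : ℝ} (hx : 0 < x) {w : ℕ → ℝ} (hw : ∀ n, 0 ≤ w n) {N : ℕ}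
    (hout : ∀ m : ℕ, x ≤ m → ∑ q ∈ Ioc 0 N, vonMangoldt q * w (m * q) ≤ Real.log m * w m)
    {F : Finset ℕ} (hF : Primitive (F : Set ℕ))
    (hFD : ∀ n ∈ F, n ∈ D ∧ x ≤ (n : ℝ) ∧ n ≤ N) :
    ∑ n ∈ F, Real.log n * w n ≤
      ∑ m ∈ Ioc 0 N with m ∈ D ∧ (m : ℝ) < x,
        ∑ q ∈ Ioc 0 N with x ≤ ((m * q : ℕ) : ℝ), vonMangoldt q * w (m * q) := by
  have hF0 : ∀ n ∈ F, 0 < n := fun n hn => by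
    have : (0 : ℝ) < n := hx.trans_le (hFD n hn).2.1
    exact_mod_cast this
  set V := (Ioc 0 N).filter
    (fun n => n ∈ D ∧ x ≤ (n : ℝ) ∧ ∀ a ∈ F, a ∣ n → a = n) with hV
  have hFV : F ⊆ V := fun n hn => by
    obtain ⟨h1, h2, h3⟩ := hFD n hn
    refine mem_filter.2 ⟨mem_Ioc.2 ⟨hF0 n hn, h3⟩, h1, h2, fun a ha han => ?_⟩
    by_contra hne
    exact hF a ha n hn hne han
  have hsplit := sum_sdiff (f := fun n : ℕ => Real.log n * w n) hFV
  have hbal : ∑ n ∈ V, Real.log n * w n =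
      ∑ p ∈ Ioc 0 N ×ˢ Ioc 0 N with p.1 * p.2 ∈ V, vonMangoldt p.2 * w (p.1 * p.2) := by
    rw [← sum_fiberwise_of_maps_to (g := fun p : ℕ × ℕ => p.1 * p.2) (t := V)
      (fun p hp => (mem_filter.1 hp).2)]
    refine sum_congr rfl fun n hn => ?_
    have hn' := mem_Ioc.1 (mem_filter.1 hn).1
    rw [filter_filter]
    have : (Ioc 0 N ×ˢ Ioc 0 N).filter (fun p : ℕ × ℕ => p.1 * p.2 ∈ V ∧ p.1 * p.2 = n) =
        n.divisorsAntidiagonal := by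
      rw [Nat.divisorsAntidiagonal_eq_prod_filter_of_le hn'.1.ne' hn'.2]
      refine filter_congr fun p _ => ⟨fun h => h.2, fun h => ⟨by rwa [h], h⟩⟩
    rw [this, ← vonMangoldt_sum, sum_mul,
      ← Nat.sum_divisorsAntidiagonal' (f := fun _ q => vonMangoldt q * w n)]
    exact sum_congr rfl fun p hp => by rw [(Nat.mem_divisorsAntidiagonal.1 hp).1]
  have hle : ∑ p ∈ Ioc 0 N ×ˢ Ioc 0 N with p.1 * p.2 ∈ V, vonMangoldt p.2 * w (p.1 * p.2) ≤
      ∑ m ∈ V \ F, ∑ q ∈ Ioc 0 N, vonMangoldt q * w (m * q) +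
      ∑ m ∈ Ioc 0 N with m ∈ D ∧ (m : ℝ) < x,
        ∑ q ∈ Ioc 0 N with x ≤ ((m * q : ℕ) : ℝ), vonMangoldt q * w (m * q) := by
    have e : V \ F = (Ioc 0 N).filter (fun m => m ∈ V \ F) := by
      ext m
      simp only [mem_filter, mem_sdiff, hV]
      tauto
    rw [e, sum_filter, sum_filter, sum_filter, sum_product, ← sum_add_distrib]
    refine sum_le_sum fun m hm => ?_
    have nn : ∀ q, 0 ≤ vonMangoldt q * w (m * q) := fun q =>
      mul_nonneg vonMangoldt_nonneg (hw _)
    by_cases hmx : (m : ℝ) < x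
    · have h1 : 0 ≤ if m ∈ V \ F then ∑ q ∈ Ioc 0 N, vonMangoldt q * w (m * q) else 0 := by
        split_ifs
        · exact sum_nonneg fun q _ => nn q
        · exact le_rfl
      refine le_add_of_nonneg_of_le h1 ?_
      by_cases hmD : m ∈ D
      · rw [if_pos ⟨hmD, hmx⟩, sum_filter]
        refine sum_le_sum fun q _ => ?_
        by_cases hq : m * q ∈ V
        · rw [if_pos hq, if_pos (mem_filter.1 hq).2.2.1]
        · rw [if_neg hq]
          split_ifs
          · exact nn q
          · exact le_rfl
      · rw [if_neg (fun h => hmD h.1)]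
        refine le_of_eq (sum_eq_zero fun q _ => if_neg fun hq => hmD ?_)
        exact hD _ (mem_filter.1 hq).2.1 m (dvd_mul_right m q)
    · rw [if_neg (c := m ∈ D ∧ (m : ℝ) < x) (fun h => hmx h.2), add_zero]
      by_cases hmV : m ∈ V \ F
      · rw [if_pos hmV]
        refine sum_le_sum fun q _ => ?_
        split_ifs
        · exact le_rfl
        · exact nn q
      · rw [if_neg hmV]
        refine le_of_eq (sum_eq_zero fun q hq => ?_)
        split_ifs with hqV
        · have hm0 := (mem_Ioc.1 hm).1
          have hqm : q = 1 := by
            by_contra hq1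
            have hq0 := (mem_Ioc.1 hq).1
            have hlt : m < m * q := lt_mul_of_one_lt_right hm0 (by omega)
            obtain ⟨h1, h2, h3, h4⟩ := mem_filter.1 hqV
            refine hmV (mem_sdiff.2 ⟨mem_filter.2 ⟨hm, hD _ h2 m (dvd_mul_right m q),
              not_lt.1 hmx, fun a ha ham => ?_⟩, fun hmF => ?_⟩)
            · have : a = m * q := h4 a ha (ham.mul_right q)
              have := Nat.le_of_dvd hm0 ham
              omega
            · have : m = m * q := h4 m hmF (dvd_mul_right m q)
              omega
          rw [hqm, vonMangoldt_apply_one, zero_mul]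
        · rfl
  have hV' : ∑ m ∈ V \ F, ∑ q ∈ Ioc 0 N, vonMangoldt q * w (m * q) ≤
      ∑ m ∈ V \ F, Real.log m * w m :=
    sum_le_sum fun m hm => hout m (mem_filter.1 (mem_sdiff.1 hm).1).2.2.1
  linarith

open Finset in
open scoped Classical in
theorem exists_sum_primitive_le :
    ∃ K : ℝ, 0 < K ∧ ∀ D : Set ℕ, (∀ n ∈ D, ∀ m : ℕ, m ∣ n → m ∈ D) →
      ∀ x : ℝ, 0 < x → 2 * K ≤ Real.log x →
      ∀ F : Finset ℕ, Primitive (F : Set ℕ) → (∀ n ∈ F, n ∈ D ∧ x ≤ (n : ℝ)) →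
      ∑ n ∈ F, 1 / ((n : ℝ) * Real.log n) ≤
        (1 + 6 * K / Real.log x) * ((1 / Real.log x) *
          ∑ m ∈ range (⌊x⌋₊ + 1) with m ∈ D, 1 / (m : ℝ)) := by
  obtain ⟨K, hK0, hK⟩ := exists_sum_Icc_vonMangoldt_div_le
  refine ⟨K, hK0, fun D hD x hx hxK F hF hFD => ?_⟩
  set L := Real.log x with hL
  have hLK : K < L := by linarith
  have hL0 : 0 < L := by linarith
  let w : ℕ → ℝ := fun n => 1 / ((Real.log n - K) ^ 2 * n)
  have hout : ∀ m : ℕ, x ≤ m →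
      ∑ q ∈ Ioc 0 (F.sup id), ArithmeticFunction.vonMangoldt q * w (m * q) ≤
        Real.log m * w m := by
    intro m hm
    have hm' : (0 : ℝ) < m := hx.trans_le hm
    have hlm : L ≤ Real.log m := Real.log_le_log hx hm
    have h := sum_vonMangoldt_mul_weight_le hK0 hK (by exact_mod_cast hm' : 0 < m) le_rfl
      (by linarith) (F.sup id)
    rw [filter_true_of_mem] at h
    · refine h.trans (le_of_eq ?_)
      simp only [w, div_eq_mul_inv, mul_inv, one_mul]
      ring
    · intro q hq
      exact_mod_cast Nat.le_mul_of_pos_right m (mem_Ioc.1 hq).1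
  have h1 := sum_primitive_le_inflow hD hx (w := w) (fun n => by positivity) hout hF
    (fun n hn => ⟨(hFD n hn).1, (hFD n hn).2, le_sup (f := id) hn⟩)
  have h2 : ∑ n ∈ F, 1 / ((n : ℝ) * Real.log n) ≤ ∑ n ∈ F, Real.log n * w n := by
    refine sum_le_sum fun n hn => ?_
    have hn' : (0 : ℝ) < n := hx.trans_le (hFD n hn).2
    have hln : L ≤ Real.log n := Real.log_le_log hx (hFD n hn).2
    have ha : 0 < Real.log n - K := by linarith
    have hb : 0 < Real.log n := by linarith
    simp only [w]
    rw [mul_one_div, div_le_div_iff₀ (by positivity) (by positivity), one_mul]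
    have : (Real.log n - K) ^ 2 ≤ Real.log n ^ 2 := by gcongr; linarith
    nlinarith
  have h3 : ∑ m ∈ Ioc 0 (F.sup id) with m ∈ D ∧ (m : ℝ) < x,
        ∑ q ∈ Ioc 0 (F.sup id) with x ≤ ((m * q : ℕ) : ℝ),
          ArithmeticFunction.vonMangoldt q * w (m * q) ≤
      L / (L - K) ^ 2 * ∑ m ∈ range (⌊x⌋₊ + 1) with m ∈ D, 1 / (m : ℝ) := by
    rw [mul_sum]
    refine (sum_le_sum fun m hm => sum_vonMangoldt_mul_weight_le hK0 hK
      (mem_Ioc.1 (mem_filter.1 hm).1).1 (mem_filter.1 hm).2.2.le hLK _).trans ?_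
    refine sum_le_sum_of_subset_of_nonneg (fun m hm => ?_) (fun m _ _ => by positivity)
    obtain ⟨_, h5, h6⟩ := mem_filter.1 hm
    exact mem_filter.2 ⟨mem_range.2 (Nat.lt_succ_of_le (Nat.le_floor h6.le)), h5⟩
  have h4 : L / (L - K) ^ 2 ≤ (1 + 6 * K / L) * (1 / L) := by
    have ha : 0 < L - K := by linarith
    have e : (1 + 6 * K / L) * (1 / L) = (L + 6 * K) / L ^ 2 := by
      field_simp
    rw [e, div_le_div_iff₀ (by positivity) (by positivity)]
    have : 0 ≤ K * (L - 2 * K) * (4 * L - 3 * K) := by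
      have : 0 ≤ L - 2 * K := by linarith
      have : 0 ≤ 4 * L - 3 * K := by linarith
      positivity
    nlinarith
  rw [← mul_assoc]
  exact (h2.trans (h1.trans h3)).trans
    (mul_le_mul_of_nonneg_right h4 (sum_nonneg fun m _ => by positivity))

open scoped Classical in
theorem tsum_one_div_of_le (D : Set ℕ) {x : ℝ} (hx : 0 ≤ x) :
    ∑' n : {n : ℕ // n ∈ D ∧ (n : ℝ) ≤ x}, 1 / ((n : ℕ) : ℝ) =
      ∑ m ∈ Finset.range (⌊x⌋₊ + 1) with m ∈ D, 1 / (m : ℝ) := by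
  have h : {n : ℕ | n ∈ D ∧ (n : ℝ) ≤ x} =
      ((Finset.range (⌊x⌋₊ + 1)).filter (· ∈ D) : Finset ℕ) := by
    ext n
    simp [Nat.le_floor_iff hx, and_comm]
  rw [← Finset.tsum_subtype' _ (fun m : ℕ => 1 / (m : ℝ)), ← h]
  rfl

open Finset in
theorem exists_sum_primitive_le_of_two_le :
    ∃ M : ℝ, 0 ≤ M ∧ ∀ F : Finset ℕ, Primitive (F : Set ℕ) → (∀ n ∈ F, 2 ≤ n) →
      ∑ n ∈ F, 1 / ((n : ℝ) * Real.log n) ≤ M := by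
  classical
  obtain ⟨K, hK0, hK⟩ := exists_sum_primitive_le
  set X := Real.exp (2 * K) with hX
  have hXL : Real.log X = 2 * K := Real.log_exp _
  set B := (1 + 6 * K / Real.log X) * ((1 / Real.log X) *
    ∑ m ∈ range (⌊X⌋₊ + 1), 1 / (m : ℝ)) with hB
  have hB0 : 0 ≤ B := by
    have := hXL ▸ (by linarith : (0 : ℝ) ≤ 2 * K)
    exact mul_nonneg (by positivity)
      (mul_nonneg (by positivity) (sum_nonneg fun m _ => by positivity))
  refine ⟨B + ∑ n ∈ range (⌊X⌋₊ + 1), 1 / ((n : ℝ) * Real.log n),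
    add_nonneg hB0 (sum_nonneg fun n _ => by positivity), fun F hF hF2 => ?_⟩
  rw [← sum_filter_add_sum_filter_not F (fun n : ℕ => X ≤ (n : ℝ))]
  refine add_le_add ?_ ?_
  · refine (hK Set.univ (fun _ _ _ _ => Set.mem_univ _) X (Real.exp_pos _) hXL.ge _ ?_ ?_).trans_eq
      (by simp only [Set.mem_univ, filter_true, hB])
    · exact fun a ha b hb => hF a (mem_of_mem_filter a ha) b (mem_of_mem_filter b hb)
    · exact fun n hn => ⟨Set.mem_univ _, (mem_filter.1 hn).2⟩
  · refine sum_le_sum_of_subset_of_nonneg (fun n hn => ?_) (fun n _ _ => by positivity)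
    have := not_le.1 (mem_filter.1 hn).2
    exact mem_range.2 (Nat.lt_succ_of_le (Nat.le_floor this.le))

theorem primitive_divisor_closed_bound :
    ∃ C : ℝ, ∀ A D : Set ℕ, Primitive A → 1 ∉ A →
      (∀ n ∈ D, ∀ m : ℕ, m ∣ n → m ∈ D) → ∀ x : ℝ, 2 ≤ x →
      ∑' n : {n : ℕ // n ∈ A ∧ n ∈ D ∧ x ≤ (n : ℝ)},
          1 / (((n : ℕ) : ℝ) * Real.log ((n : ℕ) : ℝ)) ≤
        (1 + C / Real.log x) * ((1 / Real.log x) *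
          ∑' n : {n : ℕ // n ∈ D ∧ (n : ℝ) ≤ x}, 1 / ((n : ℕ) : ℝ)) := by
  classical
  obtain ⟨K, hK0, hK⟩ := exists_sum_primitive_le
  obtain ⟨M, hM0, hM⟩ := exists_sum_primitive_le_of_two_le
  refine ⟨6 * K + M * (2 * K) ^ 2, fun A D hA _ hD x hx => ?_⟩
  have hx0 : 0 < x := by linarith
  have hL : 0 < Real.log x := Real.log_pos (by linarith)
  rw [tsum_one_div_of_le D hx0.le]
  set R := ∑ m ∈ Finset.range (⌊x⌋₊ + 1) with m ∈ D, 1 / (m : ℝ) with hR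
  have hR0 : 0 ≤ R := Finset.sum_nonneg fun m _ => by positivity
  refine Real.tsum_le_of_sum_le (fun n => by dsimp; positivity) fun s => ?_
  refine (Finset.sum_map s (Function.Embedding.subtype _)
    (fun n : ℕ => 1 / ((n : ℝ) * Real.log n))).symm.trans_le ?_
  set F := s.map (Function.Embedding.subtype _) with hFdef
  have hFA : ∀ n ∈ F, n ∈ A ∧ n ∈ D ∧ x ≤ (n : ℝ) := by
    intro n hn
    obtain ⟨a, -, rfl⟩ := Finset.mem_map.1 hn
    exact a.2
  have hF : Primitive (F : Set ℕ) := fun a ha b hb => hA a (hFA a ha).1 b (hFA b hb).1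
  rcases le_total (2 * K) (Real.log x) with h | h
  · refine (hK D hD x hx0 h F hF fun n hn => (hFA n hn).2).trans ?_
    refine mul_le_mul_of_nonneg_right ?_ (by positivity)
    gcongr
    have : 0 ≤ M * (2 * K) ^ 2 := by positivity
    linarith
  · rcases F.eq_empty_or_nonempty with hFe | ⟨n, hn⟩
    · rw [hFe, Finset.sum_empty]
      positivity
    have hD1 : 1 ∈ D := hD n (hFA n hn).2.1 1 (one_dvd n)
    have hR1 : 1 ≤ R := by
      have h1 : 1 ∈ (Finset.range (⌊x⌋₊ + 1)).filter (· ∈ D) :=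
        Finset.mem_filter.2 ⟨Finset.mem_range.2 (Nat.lt_succ_of_le (Nat.le_floor (by
          push_cast; linarith))), hD1⟩
      simpa [hR] using Finset.single_le_sum (f := fun m : ℕ => 1 / (m : ℝ))
        (fun m _ => by positivity) h1
    have h1 : ∑ n ∈ F, 1 / ((n : ℝ) * Real.log n) ≤ M := hM F hF fun n hn => by
      exact_mod_cast hx.trans (hFA n hn).2.2
    have h2 : M ≤ M * (2 * K) ^ 2 / Real.log x * (1 / Real.log x) := by
      rw [div_mul_div_comm, mul_one, le_div_iff₀ (by positivity), ← sq]
      gcongr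
    calc _ ≤ M * (2 * K) ^ 2 / Real.log x * (1 / Real.log x) := h1.trans h2
      _ ≤ (1 + (6 * K + M * (2 * K) ^ 2) / Real.log x) * (1 / Real.log x * 1) := by
        rw [mul_one]
        refine mul_le_mul_of_nonneg_right ?_ (by positivity)
        rw [add_div]
        have : 0 ≤ 6 * K / Real.log x := by positivity
        linarith
      _ ≤ _ := by gcongr
end
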